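/- arXiv:2006.06089 — 2 statements merged into one kernel-verified Lean document; each statement's English description precedes it below -/
import Mathlib

section
/- Let $1<s<\alpha<2$ and $n>2s$, and assume $\frac{n}{n-s}>2\alpha^{\sharp}$, where $\alpha^{\sharp}$ is the second largest real root of $X^3-8X+4$. Let $u\in C^{2\alpha}(\mathbb{R}^n)$ with $\int_{\mathbb{R}^n}|u(z)|(1+|z|)^{-n-s}dz<\infty$ solve $(-\Delta)^s u=e^u$ in the sense that $v:=(-\Delta)^{s/2}u$ is everywhere defined, $v(x)\to0$ as $|x|\to\infty$, and $(-\Delta)^{s/2}v=e^u$ pointwise; assume $u$ is stable outside a compact set. For $\lambda\ge1$ set $u^\lambda(x)=u(\lambda x)+2s\log\lambda$, and suppose that for each $\lambda\ge1$ there is a constant $c_\lambda\in\mathbb{R}$ such that $u^\lambda(x)=c(n,s)\int_{\mathbb{R}^n}\big(\frac{1}{|x-z|^{n-2s}}-\frac{1}{(1+|z|)^{n-2s}}\big)e^{u^\lambda(z)}\,dz + c_\lambda$ for every $x$, with $c(n,s)=\frac{\Gamma(\frac n2-s)}{4^{s}\pi^{n/2}\Gamma(s)}$. Then the constants $c_\lambda$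 are uniformly bounded: $\sup_{\lambda\ge1}|c_\lambda|<\infty$. -/
open MeasureTheory Metric Filter Set

noncomputable section

/-- Euclidean space `ℝ^n`. -/
abbrev En (n : ℕ) : Type := EuclideanSpace ℝ (Fin n)

/-- The Laplacian of `f` at `x`: the trace of the Hessian,
`Δ f (x) = ∑ i ∂²f/∂xᵢ² (x)`. -/
def lap {m : ℕ} (f : EuclideanSpace ℝ (Fin m) → ℝ) (x : EuclideanSpace ℝ (Fin m)) : ℝ :=
  ∑ i, fderiv ℝ (fun y => fderiv ℝ f y (EuclideanSpace.single i (1:ℝ))) x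
      (EuclideanSpace.single i (1:ℝ))

/-- The normalizing constant `c_{n,σ} = 4^σ Γ(n/2+σ) / (π^{n/2} |Γ(-σ)|)` of the fractional
Laplacian `(-Δ)^σ`. -/
def cFrac (n : ℕ) (σ : ℝ) : ℝ :=
  (4:ℝ) ^ σ * Real.Gamma ((n : ℝ) / 2 + σ) / (Real.pi ^ ((n : ℝ) / 2) * |Real.Gamma (-σ)|)

/-- The truncated singular integral `∫_{|x-z| ≥ ε} (w(x)-w(z))/|x-z|^{n+2σ} dz`. -/
def truncInt (n : ℕ) (σ : ℝ) (w : En n → ℝ) (x : En n) (ε : ℝ) : ℝ :=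
  ∫ z in {z : En n | ε ≤ dist x z}, (w x - w z) / dist x z ^ ((n : ℝ) + 2 * σ)

/-- The fractional Laplacian `(-Δ)^σ w (x)`, defined as the principal value
`c_{n,σ} p.v.∫ (w(x)-w(z))/|x-z|^{n+2σ} dz` (via the limit of truncated integrals as ε → 0⁺). -/
def fracLap (n : ℕ) (σ : ℝ) (w : En n → ℝ) (x : En n) : ℝ :=
  cFrac n σ * limUnder (nhdsWithin 0 (Set.Ioi 0)) (truncInt n σ w x)

/-- `HasFracLap n σ w g` means: for every `x` the principal value defining `(-Δ)^σ w (x)`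
converges, with value `g x`. -/
def HasFracLap (n : ℕ) (σ : ℝ) (w g : En n → ℝ) : Prop :=
  ∀ x, Filter.Tendsto (fun ε => cFrac n σ * truncInt n σ w x ε)
    (nhdsWithin 0 (Set.Ioi 0)) (nhds (g x))

/-- `φ ∈ C_c^∞(S)`: smooth, compactly supported, with (closed) support contained in `S`. -/
def TestOn (n : ℕ) (S : Set (En n)) (φ : En n → ℝ) : Prop :=
  ContDiff ℝ (⊤ : ℕ∞) φ ∧ HasCompactSupport φ ∧ tsupport φ ⊆ S

/-- Membership in the Hölder space `C^γ(ℝ^n)` (for non-integer `γ`): `u` is `⌊γ⌋` times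
continuously differentiable and its `⌊γ⌋`-th derivative is Hölder continuous of
exponent `γ - ⌊γ⌋`. -/
def CHolder {n : ℕ} (γ : ℝ) (u : En n → ℝ) : Prop :=
  ContDiff ℝ (⌊γ⌋₊ : ℕ) u ∧
    ∃ C : NNReal, HolderWith C (γ - (⌊γ⌋₊ : ℝ)).toNNReal (iteratedFDeriv ℝ ⌊γ⌋₊ u)

/-- `u` is stable outside the ball `B_R`:
`∫ e^u φ² ≤ ∫ |(-Δ)^{s/2} φ|²` for all `φ ∈ C_c^∞(ℝ^n \ closure B_R)`. -/
def StableOutsideBall (n : ℕ) (s : ℝ) (u : En n → ℝ) (R : ℝ) : Prop :=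
  ∀ φ : En n → ℝ, TestOn n (Metric.closedBall (0 : En n) R)ᶜ φ →
    ∫ x, Real.exp (u x) * φ x ^ 2 ≤ ∫ x, (fracLap n (s / 2) φ x) ^ 2

/-- Euclidean space `ℝ^{n+1}`; the last coordinate is the special direction `y`. -/
abbrev E1 (n : ℕ) : Type := EuclideanSpace ℝ (Fin (n + 1))

/-- The horizontal projection `ℝ^{n+1} → ℝ^n`. -/
def projx (n : ℕ) (X : E1 n) : En n :=
  (EuclideanSpace.equiv (Fin n) ℝ).symm (fun i => X (Fin.castSucc i))

/-- The Riesz normalization `c(n,s) = Γ(n/2 - s)/(4^s π^{n/2} Γ(s))`. -/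
def cRiesz (n : ℕ) (s : ℝ) : ℝ :=
  Real.Gamma ((n : ℝ) / 2 - s) / ((4:ℝ) ^ s * Real.pi ^ ((n : ℝ) / 2) * Real.Gamma s)

/-- The Poisson kernel `P_s(x,y) = κ_{n,s} y^{2s} (|x|² + y²)^{-(n/2+s)}` with
`κ_{n,s} = Γ(n/2+s)/(Γ(s) π^{n/2})`. -/
def Ps (n : ℕ) (s : ℝ) (x : En n) (y : ℝ) : ℝ :=
  (Real.Gamma ((n : ℝ) / 2 + s) / (Real.Gamma s * Real.pi ^ ((n : ℝ) / 2))) *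
    y ^ (2 * s) / ((‖x‖ ^ 2 + y ^ 2) ^ ((n : ℝ) / 2 + s))

/-- The rescaling `u^λ(x) = u(λ x) + 2s log λ`. -/
def uscale (n : ℕ) (s : ℝ) (u : En n → ℝ) (l : ℝ) (x : En n) : ℝ :=
  u (l • x) + 2 * s * Real.log l

/-- The potential `w(x) = c(n,s) ∫ (|x-z|^{2s-n} - (1+|z|)^{2s-n}) e^{g(z)} dz`. -/
def wpot (n : ℕ) (s : ℝ) (g : En n → ℝ) (x : En n) : ℝ :=
  cRiesz n s * ∫ z : En n,
    (1 / ‖x - z‖ ^ ((n : ℝ) - 2 * s) - 1 / (1 + ‖z‖) ^ ((n : ℝ) - 2 * s)) * Real.exp (g z)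

/-- The Poisson extension of `g : ℝ^n → ℝ` to the upper half-space `ℝ^{n+1}_+`. -/
def poissonExt (n : ℕ) (s : ℝ) (g : En n → ℝ) (X : E1 n) : ℝ :=
  ∫ z : En n, Ps n s (projx n X - z) (X (Fin.last n)) * g z

/-- The Riesz kernel `‖x‖^{-p}`, with value `∞` at the origin when `p > 0`. -/
def rieszKer {n : ℕ} (p : ℝ) (x : En n) : ENNReal := ‖x‖ₑ ^ (-p)

lemma measurable_rieszKer {n : ℕ} (p : ℝ) : Measurable (rieszKer (n := n) p) := by
  unfold rieszKer; fun_prop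

lemma rieszKer_of_ne {n : ℕ} (p : ℝ) {x : En n} (hx : x ≠ 0) :
    rieszKer p x = ENNReal.ofReal (‖x‖ ^ (-p)) := by
  rw [rieszKer, ← ENNReal.ofReal_rpow_of_pos (norm_pos_iff.2 hx), ofReal_norm]

lemma rieszKer_smul {n : ℕ} (p : ℝ) {r : ℝ} (hr : 0 < r) (x : En n) :
    rieszKer p (r • x) = ENNReal.ofReal (r ^ (-p)) * rieszKer p x := by
  rw [rieszKer, rieszKer, enorm_smul, ENNReal.mul_rpow_of_ne_top (by simp) (by simp),
    ← ENNReal.ofReal_rpow_of_pos hr, Real.enorm_of_nonneg hr.le]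

lemma rieszKer_anti {n : ℕ} {p : ℝ} (hp : 0 ≤ p) {x : En n} {r : ℝ} (hr : 0 < r)
    (h : r ≤ ‖x‖) : rieszKer p x ≤ ENNReal.ofReal (r ^ (-p)) := by
  have hx : x ≠ 0 := norm_pos_iff.1 (hr.trans_le h)
  rw [rieszKer_of_ne p hx]
  exact ENNReal.ofReal_le_ofReal (Real.rpow_le_rpow_of_nonpos hr h (by linarith))

lemma lintegral_comp_smul_pos {n : ℕ} (f : En n → ENNReal) {r : ℝ} (hr : 0 < r) :
    ∫⁻ x, f (r • x) = ENNReal.ofReal (r ^ (-(n : ℝ))) * ∫⁻ x, f x := by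
  let e : En n ≃ᵐ En n := (Homeomorph.smul (Units.mk0 r hr.ne')).toMeasurableEquiv
  have h1 := Measure.map_addHaar_smul (volume : Measure (En n)) hr.ne'
  have h2 := lintegral_map_equiv (μ := (volume : Measure (En n))) f e
  have h3 : Measure.map e (volume : Measure (En n)) = Measure.map (fun x => r • x) volume := rfl
  rw [h3, h1, lintegral_smul_measure] at h2
  have h4 : ∫⁻ x, f (e x) = ∫⁻ x, f (r • x) := rfl
  rw [← h4, ← h2, smul_eq_mul, Real.rpow_neg hr.le, abs_of_pos (by positivity)]
  simp

lemma setLIntegral_rieszKer_scale {n : ℕ} (p : ℝ) {r : ℝ} (hr : 0 < r) {S T : Set (En n)}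
    (hS : MeasurableSet S) (hT : MeasurableSet T) (hST : ∀ x, r • x ∈ S ↔ x ∈ T) :
    ∫⁻ x in S, rieszKer p x = ENNReal.ofReal (r ^ ((n : ℝ) - p)) * ∫⁻ x in T, rieszKer p x := by
  have h := lintegral_comp_smul_pos (n := n) (S.indicator (rieszKer p)) hr
  rw [lintegral_indicator hS] at h
  have h5 : (fun x => S.indicator (rieszKer p) (r • x)) =
      T.indicator (fun x => ENNReal.ofReal (r ^ (-p)) * rieszKer p x) := by
    ext x
    by_cases hx : x ∈ T
    · simp [hx, (hST x).2 hx, rieszKer_smul p hr]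
    · simp [hx, mt (hST x).1 hx]
  rw [h5, lintegral_indicator hT, lintegral_const_mul _ (measurable_rieszKer p)] at h
  have h6 : ENNReal.ofReal (r ^ (n : ℝ)) * ENNReal.ofReal (r ^ (-(n : ℝ))) = 1 := by
    rw [← ENNReal.ofReal_mul (by positivity), ← Real.rpow_add hr]; simp
  calc _ = (ENNReal.ofReal (r ^ (n : ℝ)) * ENNReal.ofReal (r ^ (-(n : ℝ)))) *
        ∫⁻ x in S, rieszKer p x := by rw [h6, one_mul]
    _ = _ := by
      rw [mul_assoc, ← h, ← mul_assoc, ← ENNReal.ofReal_mul (by positivity), ← Real.rpow_add hr,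
        sub_eq_add_neg]

lemma smul_mem_ball_iff {n : ℕ} {r : ℝ} (hr : 0 < r) (x : En n) :
    r • x ∈ ball (0 : En n) r ↔ x ∈ ball (0 : En n) 1 := by
  simp only [mem_ball_zero_iff, norm_smul, Real.norm_eq_abs, abs_of_pos hr]
  exact mul_lt_iff_lt_one_right hr

lemma lintegral_ball_rieszKer {n : ℕ} (p : ℝ) {r : ℝ} (hr : 0 < r) :
    ∫⁻ x in ball (0 : En n) r, rieszKer p x =
      ENNReal.ofReal (r ^ ((n : ℝ) - p)) * ∫⁻ x in ball (0 : En n) 1, rieszKer p x :=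
  setLIntegral_rieszKer_scale p hr measurableSet_ball measurableSet_ball (smul_mem_ball_iff hr)

lemma lintegral_compl_ball_rieszKer {n : ℕ} (p : ℝ) {r : ℝ} (hr : 0 < r) :
    ∫⁻ x in (ball (0 : En n) r)ᶜ, rieszKer p x =
      ENNReal.ofReal (r ^ ((n : ℝ) - p)) * ∫⁻ x in (ball (0 : En n) 1)ᶜ, rieszKer p x :=
  setLIntegral_rieszKer_scale p hr measurableSet_ball.compl measurableSet_ball.compl
    fun x => not_congr (smul_mem_ball_iff hr x)

lemma lintegral_unitBall_rieszKer_lt_top {n : ℕ} (hn : 1 ≤ n) {p : ℝ} (hp : p < n) :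
    ∫⁻ x in ball (0 : En n) 1, rieszKer p x < ⊤ := by
  have : Nonempty (Fin n) := ⟨⟨0, hn⟩⟩
  have : Nontrivial (En n) := inferInstance
  have h : IntegrableOn (fun x : En n => ‖x‖ ^ (-p)) (ball 0 1) := by
    refine integrableOn_ball_of_norm_le_rpow (C := 1) (α := p) (by simpa using hn)
      (by simpa using hp) ?_ ?_
    · refine Eventually.of_forall fun x => ?_
      rw [one_mul, Real.norm_eq_abs, abs_of_nonneg (by positivity)]
    · exact (by fun_prop : Measurable fun x : En n => ‖x‖ ^ (-p)).aestronglyMeasurable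
  have h2 : ∫⁻ x in ball (0 : En n) 1, rieszKer p x =
      ∫⁻ x in ball (0 : En n) 1, ENNReal.ofReal (‖x‖ ^ (-p)) := by
    refine lintegral_congr_ae (ae_restrict_of_ae ?_)
    filter_upwards [compl_mem_ae_iff.2 (measure_singleton (0 : En n))] with x hx
    exact rieszKer_of_ne p hx
  rw [h2]
  exact h.lintegral_lt_top

lemma lintegral_compl_unitBall_rieszKer_lt_top {n : ℕ} {p : ℝ} (hp : n < p) :
    ∫⁻ x in (ball (0 : En n) 1)ᶜ, rieszKer p x < ⊤ := by
  have hp0 : 0 < p := (Nat.cast_nonneg n).trans_lt hp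
  have h : Integrable (fun x : En n => 2 ^ p * (1 + ‖x‖) ^ (-p)) :=
    (integrable_one_add_norm (by simpa using hp)).const_mul _
  refine lt_of_le_of_lt ?_ (h.integrableOn (s := (ball (0 : En n) 1)ᶜ)).lintegral_lt_top
  refine setLIntegral_mono' measurableSet_ball.compl fun x hx => ?_
  have hx1 : 1 ≤ ‖x‖ := by simpa using hx
  rw [rieszKer_of_ne p (norm_pos_iff.1 (by linarith))]
  refine ENNReal.ofReal_le_ofReal ?_
  have : (‖x‖) ^ (-p) = 2 ^ p * (2 * ‖x‖) ^ (-p) := by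
    rw [Real.mul_rpow (by norm_num) (by positivity), ← mul_assoc, ← Real.rpow_add (by norm_num)]
    simp
  rw [this]
  gcongr 2 ^ p * ?_
  exact Real.rpow_le_rpow_of_nonpos (by positivity) (by linarith) (by linarith)

lemma rieszKer_mul_le {n : ℕ} {p : ℝ} (hp : 0 ≤ p) {y z : En n} (hyz : y ≠ z) (x : En n) :
    rieszKer p (x - y) * rieszKer p (x - z) ≤
      (ENNReal.ofReal ((‖y - z‖ / 2) ^ (-p)) *
          (ball (0 : En n) (‖y - z‖ / 2)).indicator (rieszKer p) (x - y) +
        ENNReal.ofReal ((‖y - z‖ / 2) ^ (-p)) *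
          (ball (0 : En n) (‖y - z‖ / 2)).indicator (rieszKer p) (x - z)) +
      ((ball (0 : En n) (‖y - z‖ / 2))ᶜ.indicator (rieszKer (2 * p)) (x - y) +
        (ball (0 : En n) (‖y - z‖ / 2))ᶜ.indicator (rieszKer (2 * p)) (x - z)) := by
  have hd : 0 < ‖y - z‖ / 2 := half_pos (norm_pos_iff.2 (sub_ne_zero.2 hyz))
  have htri : ‖y - z‖ ≤ ‖x - y‖ + ‖x - z‖ := by
    have : y - z = (x - z) - (x - y) := by abel
    rw [this, add_comm]; exact norm_sub_le _ _
  have hsq : ∀ w : En n, rieszKer p w * rieszKer p w = rieszKer (2 * p) w := by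
    intro w
    rcases eq_or_ne w 0 with rfl | hw
    · rcases hp.eq_or_lt with rfl | hp
      · simp [rieszKer]
      · simp [rieszKer, ENNReal.zero_rpow_of_neg, hp]
    · rw [rieszKer, rieszKer, ← ENNReal.rpow_add _ _ (by simpa using hw) (by simp)]
      congr 1; ring
  set d := ‖y - z‖ / 2 with hdd
  by_cases h1 : x - y ∈ ball (0 : En n) d
  · refine le_trans ?_ (le_trans le_self_add le_self_add)
    rw [indicator_of_mem h1, mul_comm]
    gcongr
    refine rieszKer_anti hp hd ?_
    rw [mem_ball_zero_iff] at h1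
    linarith
  by_cases h2 : x - z ∈ ball (0 : En n) d
  · refine le_trans ?_ (le_trans le_add_self le_self_add)
    rw [indicator_of_mem h2]
    gcongr
    refine rieszKer_anti hp hd ?_
    rw [mem_ball_zero_iff] at h2
    linarith
  · refine le_trans ?_ le_add_self
    rw [indicator_of_mem (mem_compl h1), indicator_of_mem (mem_compl h2)]
    rcases le_total (rieszKer p (x - y)) (rieszKer p (x - z)) with h | h
    · calc _ ≤ rieszKer p (x - z) * rieszKer p (x - z) := by gcongr
        _ ≤ _ := by rw [hsq]; exact le_add_self
    · calc _ ≤ rieszKer p (x - y) * rieszKer p (x - y) := by gcongr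
        _ ≤ _ := by rw [hsq]; exact le_self_add

/-- Composition estimate for Riesz kernels. -/
lemma exists_lintegral_rieszKer_mul_le {n : ℕ} (hn : 1 ≤ n) {p : ℝ} (hp : (n : ℝ) < 2 * p)
    (hpn : p < n) : ∃ C : ENNReal, C ≠ ⊤ ∧ ∀ y z : En n,
      ∫⁻ x, rieszKer p (x - y) * rieszKer p (x - z) ≤ C * rieszKer (2 * p - n) (y - z) := by
  have hp0 : 0 < p := by have := Nat.cast_nonneg (α := ℝ) n; linarith
  set I := ∫⁻ x in ball (0 : En n) 1, rieszKer p x with hI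
  set J := ∫⁻ x in (ball (0 : En n) 1)ᶜ, rieszKer (2 * p) x with hJ
  have hIt : I ≠ ⊤ := (lintegral_unitBall_rieszKer_lt_top hn hpn).ne
  have hJt : J ≠ ⊤ := (lintegral_compl_unitBall_rieszKer_lt_top hp).ne
  refine ⟨(2 * (I + J)) * ENNReal.ofReal (2 ^ (2 * p - n)) + 1, by finiteness, fun y z => ?_⟩
  rcases eq_or_ne y z with rfl | hyz
  · have : rieszKer (2 * p - n) (y - y) = ⊤ := by
      rw [sub_self, rieszKer, enorm_zero, ENNReal.zero_rpow_of_neg (by linarith)]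
    rw [this, ENNReal.mul_top (by simp)]
    exact le_top
  have hd : 0 < ‖y - z‖ / 2 := half_pos (norm_pos_iff.2 (sub_ne_zero.2 hyz))
  have hyz0 : 0 < ‖y - z‖ := by linarith
  have key := lintegral_mono (μ := (volume : Measure (En n)))
    (rieszKer_mul_le hp0.le hyz)
  refine key.trans ?_
  have hm1 : Measurable ((ball (0 : En n) (‖y - z‖ / 2)).indicator (rieszKer (n := n) p)) :=
    (measurable_rieszKer p).indicator measurableSet_ball
  have hm2 : Measurable ((ball (0 : En n) (‖y - z‖ / 2))ᶜ.indicator (rieszKer (n := n) (2 * p))) :=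
    (measurable_rieszKer _).indicator measurableSet_ball.compl
  rw [lintegral_add_left (by fun_prop), lintegral_add_left (by fun_prop),
    lintegral_add_left (by fun_prop), lintegral_const_mul _ (by fun_prop),
    lintegral_const_mul _ (by fun_prop),
    lintegral_sub_right_eq_self ((ball (0 : En n) (‖y - z‖ / 2)).indicator (rieszKer p)) y,
    lintegral_sub_right_eq_self ((ball (0 : En n) (‖y - z‖ / 2)).indicator (rieszKer p)) z,
    lintegral_sub_right_eq_self
      ((ball (0 : En n) (‖y - z‖ / 2))ᶜ.indicator (rieszKer (2 * p))) y,
    lintegral_sub_right_eq_self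
      ((ball (0 : En n) (‖y - z‖ / 2))ᶜ.indicator (rieszKer (2 * p))) z,
    lintegral_indicator measurableSet_ball, lintegral_indicator measurableSet_ball.compl,
    lintegral_ball_rieszKer p hd, lintegral_compl_ball_rieszKer _ hd, ← hI, ← hJ, ← mul_assoc,
    ← ENNReal.ofReal_mul (by positivity), ← Real.rpow_add hd]
  have e1 : -p + ((n : ℝ) - p) = -(2 * p - n) := by ring
  have e2 : (n : ℝ) - 2 * p = -(2 * p - n) := by ring
  have e3 : (‖y - z‖ / 2) ^ (-(2 * p - (n : ℝ))) =
      2 ^ (2 * p - n) * ‖y - z‖ ^ (-(2 * p - (n : ℝ))) := by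
    rw [Real.div_rpow (by positivity) (by norm_num), Real.rpow_neg (by norm_num : (0 : ℝ) ≤ 2)]
    field_simp
  rw [e1, e2, e3, ENNReal.ofReal_mul (by positivity), ← rieszKer_of_ne _ (sub_ne_zero.2 hyz),
    add_mul]
  refine le_trans (le_of_eq ?_) le_self_add
  ring

lemma integrableOn_ball_rpow {n : ℕ} (hn : 1 ≤ n) {p : ℝ} (hp : p < n) (r : ℝ) :
    IntegrableOn (fun x : En n => ‖x‖ ^ (-p)) (ball 0 r) := by
  refine integrableOn_ball_of_norm_le_rpow (C := 1) (α := p) (by simpa using hn)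
    (by simpa using hp) (Eventually.of_forall fun x => ?_) ?_
  · rw [one_mul, Real.norm_eq_abs, abs_of_nonneg (by positivity)]
  · exact (by fun_prop : Measurable fun x : En n => ‖x‖ ^ (-p)).aestronglyMeasurable

lemma integrableOn_compl_ball_rpow {n : ℕ} {q : ℝ} (hq : n < q) {r : ℝ} (hr : 0 < r) :
    IntegrableOn (fun x : En n => ‖x‖ ^ (-q)) (ball 0 r)ᶜ := by
  refine ⟨(by fun_prop : Measurable fun x : En n => ‖x‖ ^ (-q)).aestronglyMeasurable, ?_⟩
  rw [hasFiniteIntegral_iff_ofReal (Eventually.of_forall fun x => by positivity)]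
  have h : ∫⁻ x in (ball (0 : En n) r)ᶜ, ENNReal.ofReal (‖x‖ ^ (-q)) =
      ∫⁻ x in (ball (0 : En n) r)ᶜ, rieszKer q x := by
    refine setLIntegral_congr_fun measurableSet_ball.compl fun x hx => ?_
    have hx1 : r ≤ ‖x‖ := by simpa using hx
    exact (rieszKer_of_ne q (norm_pos_iff.1 (by linarith))).symm
  rw [h, lintegral_compl_ball_rieszKer q hr]
  exact ENNReal.mul_lt_top (by simp) (lintegral_compl_unitBall_rieszKer_lt_top hq)

lemma truncInt_eq {n : ℕ} (σ : ℝ) (f : En n → ℝ) (x : En n) (ε : ℝ) :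
    truncInt n σ f x ε =
      ∫ z in (ball (0 : En n) ε)ᶜ, (f x - f (x - z)) * ‖z‖ ^ (-((n : ℝ) + 2 * σ)) := by
  have hS : MeasurableSet {z : En n | ε ≤ dist x z} :=
    measurableSet_le measurable_const (by fun_prop)
  rw [truncInt, ← integral_indicator hS, ← integral_indicator measurableSet_ball.compl,
    ← integral_sub_left_eq_self _ volume x]
  refine integral_congr_ae (Eventually.of_forall fun z => ?_)
  by_cases hz : ε ≤ ‖z‖
  · have h1 : x - z ∈ {z : En n | ε ≤ dist x z} := by simpa [dist_eq_norm] using hz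
    have h2 : z ∈ (ball (0 : En n) ε)ᶜ := by simpa using hz
    beta_reduce
    rw [indicator_of_mem h1, indicator_of_mem h2]
    simp only [dist_eq_norm, sub_sub_cancel]
    rw [Real.rpow_neg (norm_nonneg _), div_eq_mul_inv]
  · have h1 : x - z ∉ {z : En n | ε ≤ dist x z} := by simpa [dist_eq_norm] using hz
    have h2 : z ∉ (ball (0 : En n) ε)ᶜ := by simpa using hz
    simp only [indicator_of_notMem h1, indicator_of_notMem h2]

lemma integrableOn_truncInt {n : ℕ} {σ : ℝ} (hσ : 0 < σ) {f : En n → ℝ} (hf : Continuous f)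
    {M : ℝ} (hM : ∀ x, |f x| ≤ M) (x : En n) {ε : ℝ} (hε : 0 < ε) :
    IntegrableOn (fun z => (f x - f (x - z)) * ‖z‖ ^ (-((n : ℝ) + 2 * σ)))
      (ball (0 : En n) ε)ᶜ := by
  refine Integrable.bdd_mul (c := 2 * M)
    (integrableOn_compl_ball_rpow (by linarith) hε) ?_ ?_
  · exact Continuous.aestronglyMeasurable (by fun_prop)
  · refine Eventually.of_forall fun z => ?_
    rw [Real.norm_eq_abs]
    have h1 := abs_le.1 (hM x)
    have h2 := abs_le.1 (hM (x - z))
    exact abs_le.2 ⟨by linarith, by linarith⟩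

lemma truncInt_eq_symm {n : ℕ} {σ : ℝ} (hσ : 0 < σ) {f : En n → ℝ} (hf : Continuous f)
    {M : ℝ} (hM : ∀ x, |f x| ≤ M) (x : En n) {ε : ℝ} (hε : 0 < ε) :
    truncInt n σ f x ε = ∫ z in (ball (0 : En n) ε)ᶜ,
      (2 * f x - f (x - z) - f (x + z)) / 2 * ‖z‖ ^ (-((n : ℝ) + 2 * σ)) := by
  have h1 := integrableOn_truncInt hσ hf hM x hε
  have hind : ∀ z, (ball (0 : En n) ε)ᶜ.indicator
        (fun z => (f x - f (x - z)) * ‖z‖ ^ (-((n : ℝ) + 2 * σ))) (-z) =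
      (ball (0 : En n) ε)ᶜ.indicator
        (fun z => (f x - f (x + z)) * ‖z‖ ^ (-((n : ℝ) + 2 * σ))) z := by
    intro z
    simp only [indicator, mem_compl_iff, mem_ball_zero_iff, norm_neg, sub_neg_eq_add]
  have h2 : IntegrableOn (fun z => (f x - f (x + z)) * ‖z‖ ^ (-((n : ℝ) + 2 * σ)))
      (ball (0 : En n) ε)ᶜ := by
    rw [← integrable_indicator_iff measurableSet_ball.compl] at h1 ⊢
    exact h1.comp_neg.congr (Eventually.of_forall hind)
  have h3 : truncInt n σ f x ε =
      ∫ z in (ball (0 : En n) ε)ᶜ, (f x - f (x + z)) * ‖z‖ ^ (-((n : ℝ) + 2 * σ)) := by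
    rw [truncInt_eq, ← integral_indicator measurableSet_ball.compl,
      ← integral_indicator measurableSet_ball.compl, ← integral_neg_eq_self]
    exact integral_congr_ae (Eventually.of_forall hind)
  have h4 : truncInt n σ f x ε = (truncInt n σ f x ε + truncInt n σ f x ε) / 2 := by ring
  rw [h4]
  nth_rw 2 [h3]
  rw [truncInt_eq, ← integral_add h1 h2, ← integral_div]
  refine integral_congr_ae (Eventually.of_forall fun z => ?_)
  simp only
  ring

lemma exists_second_difference_le {n : ℕ} {f : En n → ℝ} (hf : ContDiff ℝ 2 f)
    (hc : HasCompactSupport f) :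
    ∃ C, 0 ≤ C ∧ ∀ x z, |2 * f x - f (x - z) - f (x + z)| ≤ C * ‖z‖ ^ 2 := by
  obtain ⟨C, hC⟩ := ContDiff.lipschitzWith_of_hasCompactSupport (hc.fderiv (𝕜 := ℝ))
    (hf.fderiv_right (m := 1) (by norm_num)) (by norm_num)
  have key : ∀ x z, |f (x + z) - f x - fderiv ℝ f x z| ≤ C * ‖z‖ ^ 2 := by
    intro x z
    have h := Convex.norm_image_sub_le_of_norm_fderiv_le' (𝕜 := ℝ) (f := f) (C := C * ‖z‖)
      (s := closedBall x ‖z‖) (x := x) (y := x + z) (φ := fderiv ℝ f x)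
      (fun y _ => (hf.differentiable (by norm_num)).differentiableAt)
      (fun y hy => ?_) (convex_closedBall _ _) (by simp) (by simp)
    · rw [add_sub_cancel_left, Real.norm_eq_abs] at h
      linarith [h]
    · refine (hC.norm_sub_le y x).trans ?_
      rw [mem_closedBall, dist_eq_norm] at hy
      gcongr
  refine ⟨2 * C, by positivity, fun x z => ?_⟩
  have h1 := abs_le.1 (key x z)
  have h2 := abs_le.1 (key x (-z))
  rw [map_neg, norm_neg, ← sub_eq_add_neg] at h2
  exact abs_le.2 ⟨by linarith, by linarith⟩

lemma HasCompactSupport.exists_abs_le {n : ℕ} {f : En n → ℝ} (hf : Continuous f)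
    (hc : HasCompactSupport f) : ∃ M, 0 ≤ M ∧ ∀ x, |f x| ≤ M := by
  obtain ⟨M, hM⟩ := hc.exists_bound_of_continuous hf
  exact ⟨M, (norm_nonneg _).trans (hM 0), hM⟩

/-- The symmetrised singular integrand of a `C²_c` function has an integrable majorant. -/
lemma exists_integrable_majorant {n : ℕ} (hn : 1 ≤ n) {σ : ℝ} (hσ : 0 < σ) (hσ1 : σ < 1)
    {f : En n → ℝ} (hf : ContDiff ℝ 2 f) (hc : HasCompactSupport f) :
    ∃ G : En n → ℝ, Integrable G ∧ (∀ z, 0 ≤ G z) ∧ ∀ x z, z ≠ 0 →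
      |(2 * f x - f (x - z) - f (x + z)) / 2 * ‖z‖ ^ (-((n : ℝ) + 2 * σ))| ≤ G z := by
  obtain ⟨C, hC0, hC⟩ := exists_second_difference_le hf hc
  obtain ⟨M, hM0, hM⟩ := hc.exists_abs_le hf.continuous
  refine ⟨fun z => (ball (0 : En n) 1).indicator
      (fun z => C * ‖z‖ ^ (-((n : ℝ) + 2 * σ - 2))) z +
      (ball (0 : En n) 1)ᶜ.indicator (fun z => 2 * M * ‖z‖ ^ (-((n : ℝ) + 2 * σ))) z,
    ?_, ?_, ?_⟩
  · refine Integrable.add ?_ ?_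
    · rw [integrable_indicator_iff measurableSet_ball]
      exact (integrableOn_ball_rpow hn (by linarith) 1).const_mul C
    · rw [integrable_indicator_iff measurableSet_ball.compl]
      exact (integrableOn_compl_ball_rpow (by linarith) one_pos).const_mul _
  · intro z
    refine add_nonneg (indicator_nonneg (fun z _ => by positivity) z)
      (indicator_nonneg (fun z _ => by positivity) z)
  · intro x z hz
    have hz0 : 0 < ‖z‖ := norm_pos_iff.2 hz
    have hp : (0 : ℝ) ≤ ‖z‖ ^ (-((n : ℝ) + 2 * σ)) := by positivity
    rw [abs_mul, abs_of_nonneg hp]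
    by_cases h : z ∈ ball (0 : En n) 1
    · have h' : z ∉ (ball (0 : En n) 1)ᶜ := fun h2 => h2 h
      simp only [indicator_of_mem h, indicator_of_notMem h', add_zero]
      have e : ‖z‖ ^ (-((n : ℝ) + 2 * σ - 2)) = ‖z‖ ^ 2 * ‖z‖ ^ (-((n : ℝ) + 2 * σ)) := by
        rw [← Real.rpow_natCast, ← Real.rpow_add hz0]; congr 1; push_cast; ring
      rw [e, ← mul_assoc]
      gcongr
      rw [abs_div, abs_two]
      have := hC x z
      have h3 : 0 ≤ C * ‖z‖ ^ 2 := by positivity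
      linarith
    · simp only [indicator_of_notMem h, indicator_of_mem (mem_compl h), zero_add]
      gcongr
      have h1 := abs_le.1 (hM x)
      have h2 := abs_le.1 (hM (x - z))
      have h3 := abs_le.1 (hM (x + z))
      exact abs_le.2 ⟨by linarith, by linarith⟩

lemma exists_abs_truncInt_le {n : ℕ} (hn : 1 ≤ n) {σ : ℝ} (hσ : 0 < σ) (hσ1 : σ < 1)
    {f : En n → ℝ} (hf : ContDiff ℝ 2 f) (hc : HasCompactSupport f) :
    ∃ B, 0 ≤ B ∧ ∀ x ε, 0 < ε → |truncInt n σ f x ε| ≤ B := by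
  obtain ⟨G, hG, hG0, hGb⟩ := exists_integrable_majorant hn hσ hσ1 hf hc
  obtain ⟨M, hM0, hM⟩ := hc.exists_abs_le hf.continuous
  refine ⟨∫ z, G z, integral_nonneg hG0, fun x ε hε => ?_⟩
  rw [truncInt_eq_symm hσ hf.continuous hM x hε, ← Real.norm_eq_abs]
  refine (norm_integral_le_of_norm_le hG.integrableOn ?_).trans
    (setIntegral_le_integral hG (Eventually.of_forall hG0))
  refine (ae_restrict_iff' measurableSet_ball.compl).2 (Eventually.of_forall fun z hz => ?_)
  refine hGb x z ?_
  rintro rfl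
  exact hz (by simpa using hε)

lemma exists_tendsto_truncInt {n : ℕ} (hn : 1 ≤ n) {σ : ℝ} (hσ : 0 < σ) (hσ1 : σ < 1)
    {f : En n → ℝ} (hf : ContDiff ℝ 2 f) (hc : HasCompactSupport f) (x : En n) :
    ∃ L, Tendsto (truncInt n σ f x) (nhdsWithin 0 (Ioi 0)) (nhds L) := by
  obtain ⟨G, hG, hG0, hGb⟩ := exists_integrable_majorant hn hσ hσ1 hf hc
  obtain ⟨M, hM0, hM⟩ := hc.exists_abs_le hf.continuous
  set F : En n → ℝ :=
    fun z => (2 * f x - f (x - z) - f (x + z)) / 2 * ‖z‖ ^ (-((n : ℝ) + 2 * σ)) with hF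
  have hFm : Measurable F := by
    have := hf.continuous.measurable
    fun_prop
  refine ⟨∫ z, F z, ?_⟩
  have hev : ∀ᶠ ε in nhdsWithin (0 : ℝ) (Ioi 0), 0 < ε := self_mem_nhdsWithin
  have ht : Tendsto (fun ε => ∫ z, (ball (0 : En n) ε)ᶜ.indicator F z) (nhdsWithin 0 (Ioi 0))
      (nhds (∫ z, F z)) := by
    refine tendsto_integral_filter_of_dominated_convergence G ?_ ?_ hG ?_
    · exact Eventually.of_forall fun ε =>
        (hFm.indicator measurableSet_ball.compl).aestronglyMeasurable
    · filter_upwards [hev] with ε hε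
      refine Eventually.of_forall fun z => ?_
      by_cases hz : z ∈ (ball (0 : En n) ε)ᶜ
      · rw [indicator_of_mem hz]
        refine hGb x z ?_
        rintro rfl
        exact hz (by simpa using hε)
      · rw [indicator_of_notMem hz, norm_zero]; exact hG0 z
    · have hne : Nonempty (Fin n) := ⟨⟨0, hn⟩⟩
      filter_upwards [compl_mem_ae_iff.2 (measure_singleton (0 : En n))] with z hz
      have hz0 : 0 < ‖z‖ := norm_pos_iff.2 hz
      refine tendsto_const_nhds.congr' ?_
      filter_upwards [nhdsWithin_le_nhds (Iio_mem_nhds hz0)] with ε hε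
      have : z ∈ (ball (0 : En n) ε)ᶜ := by simpa using (le_of_lt hε)
      rw [indicator_of_mem this]
  refine ht.congr' ?_
  filter_upwards [hev] with ε hε
  rw [truncInt_eq_symm hσ hf.continuous hM x hε, integral_indicator measurableSet_ball.compl]

lemma fracLap_eq_of_tendsto {n : ℕ} {σ : ℝ} {f : En n → ℝ} {x : En n} {L : ℝ}
    (h : Tendsto (truncInt n σ f x) (nhdsWithin 0 (Ioi 0)) (nhds L)) :
    fracLap n σ f x = cFrac n σ * L := by
  rw [fracLap, h.limUnder_eq]

lemma enorm_fracLap_le {n : ℕ} (hn : 1 ≤ n) {σ : ℝ} (hσ : 0 < σ) (hσ1 : σ < 1)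
    {f : En n → ℝ} (hf : ContDiff ℝ 2 f) (hc : HasCompactSupport f) {x : En n} {K : ENNReal}
    (hK : ∀ ε, 0 < ε → ‖truncInt n σ f x ε‖ₑ ≤ K) :
    ‖fracLap n σ f x‖ₑ ≤ ‖cFrac n σ‖ₑ * K := by
  obtain ⟨L, hL⟩ := exists_tendsto_truncInt hn hσ hσ1 hf hc x
  rw [fracLap_eq_of_tendsto hL, enorm_mul]
  gcongr
  refine le_of_tendsto hL.enorm ?_
  filter_upwards [self_mem_nhdsWithin] with ε hε using hK ε hε

lemma exists_abs_truncInt_le_rpow {n : ℕ} (hn : 1 ≤ n) {σ : ℝ} (hσ : 0 < σ) (hσ1 : σ < 1)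
    {f : En n → ℝ} (hf : ContDiff ℝ 2 f) (hc : HasCompactSupport f) :
    ∃ B, 0 ≤ B ∧ ∀ x ε, 0 < ε → |truncInt n σ f x ε| ≤ B ∧
      (x ≠ 0 → |truncInt n σ f x ε| ≤ B * ‖x‖ ^ (-((n : ℝ) + 2 * σ))) := by
  obtain ⟨B, hB0, hB⟩ := exists_abs_truncInt_le hn hσ hσ1 hf hc
  obtain ⟨ρ, hρ0, hρ⟩ := hc.isCompact.isBounded.subset_closedBall_lt 0 0
  have hfi : Integrable f := hf.continuous.integrable_of_hasCompactSupport hc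
  set q : ℝ := (n : ℝ) + 2 * σ with hq
  have hq0 : 0 < q := by positivity
  set I := ∫ z, |f z| with hI
  have hI0 : 0 ≤ I := integral_nonneg fun z => abs_nonneg _
  have hfar : ∀ x ε, 2 * ρ ≤ ‖x‖ → |truncInt n σ f x ε| ≤ 2 ^ q * I * ‖x‖ ^ (-q) := by
    intro x ε hx
    have hx0 : 0 < ‖x‖ := by linarith
    have hS : MeasurableSet {z : En n | ε ≤ dist x z} :=
      measurableSet_le measurable_const (by fun_prop)
    have hb : ∀ z, z ≠ x → ‖(f x - f z) / dist x z ^ q‖ ≤ (‖x‖ / 2) ^ (-q) * |f z| := by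
      intro z hzx
      by_cases hz : f z = 0
      · have : f x = 0 := by
          by_contra h
          have := hρ (subset_tsupport f h)
          rw [mem_closedBall_zero_iff] at this
          linarith
        simp [hz, this]
      · have hz1 := hρ (subset_tsupport f hz)
        rw [mem_closedBall_zero_iff] at hz1
        have hd : ‖x‖ / 2 ≤ dist x z := by
          rw [dist_eq_norm]
          have := norm_sub_norm_le x z
          linarith
        have hd0 : 0 < dist x z := by linarith
        by_cases hfx : f x = 0
        · rw [hfx, zero_sub, norm_div, norm_neg, Real.norm_eq_abs, Real.norm_eq_abs,
            abs_of_nonneg (by positivity : (0 : ℝ) ≤ dist x z ^ q), div_eq_inv_mul,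
            ← Real.rpow_neg hd0.le]
          gcongr ?_ * _
          exact Real.rpow_le_rpow_of_nonpos (by positivity) hd (by linarith)
        · exfalso
          have := hρ (subset_tsupport f hfx)
          rw [mem_closedBall_zero_iff] at this
          linarith
    have hne : Nonempty (Fin n) := ⟨⟨0, hn⟩⟩
    have h1 := norm_integral_le_of_norm_le (μ := volume.restrict {z : En n | ε ≤ dist x z})
      (f := fun z => (f x - f z) / dist x z ^ q)
      (hfi.abs.const_mul ((‖x‖ / 2) ^ (-q))).integrableOn (ae_restrict_of_ae (by
        filter_upwards [compl_mem_ae_iff.2 (measure_singleton x)] with z hz using hb z hz))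
    refine (h1.trans (setIntegral_le_integral (hfi.abs.const_mul _)
      (Eventually.of_forall fun z => by positivity))).trans (le_of_eq ?_)
    rw [integral_const_mul, ← hI, Real.div_rpow hx0.le (by norm_num),
      Real.rpow_neg (by norm_num : (0 : ℝ) ≤ 2)]
    field_simp
  refine ⟨B + B * (2 * ρ) ^ q + 2 ^ q * I, by positivity, fun x ε hε => ⟨?_, fun hx => ?_⟩⟩
  · refine (hB x ε hε).trans ?_
    have h1 : 0 ≤ B * (2 * ρ) ^ q := by positivity
    have h2 : 0 ≤ 2 ^ q * I := by positivity
    linarith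
  · have hx0 : 0 < ‖x‖ := norm_pos_iff.2 hx
    have hxq : 0 < ‖x‖ ^ (-q) := by positivity
    rcases le_total (2 * ρ) ‖x‖ with h | h
    · refine (hfar x ε h).trans ?_
      gcongr
      have : 0 ≤ B * (2 * ρ) ^ q := by positivity
      linarith
    · have h3 : B ≤ B * (2 * ρ) ^ q * ‖x‖ ^ (-q) := by
        have : 1 ≤ (2 * ρ) ^ q * ‖x‖ ^ (-q) := by
          rw [Real.rpow_neg hx0.le, ← div_eq_mul_inv, le_div_iff₀ (by positivity), one_mul]
          gcongr
        nlinarith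
      refine ((hB x ε hε).trans h3).trans ?_
      gcongr
      have h2 : 0 ≤ 2 ^ q * I := by positivity
      linarith

open scoped Pointwise in
lemma truncInt_comp_smul {n : ℕ} (σ : ℝ) (f : En n → ℝ) {r : ℝ} (hr : 0 < r) (x : En n) (ε : ℝ) :
    truncInt n σ (fun y => f (r • y)) x ε = r ^ (2 * σ) * truncInt n σ f (r • x) (r * ε) := by
  have h := Measure.setIntegral_comp_smul_of_pos (volume : Measure (En n))
    (fun w => (f (r • x) - f w) / dist (r • x) w ^ ((n : ℝ) + 2 * σ))
    {z : En n | ε ≤ dist x z} hr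
  have hS : r • {z : En n | ε ≤ dist x z} = {w : En n | r * ε ≤ dist (r • x) w} := by
    ext w
    rw [mem_smul_set_iff_inv_smul_mem₀ hr.ne']
    have : dist (r • x) w = r * dist x (r⁻¹ • w) := by
      rw [← abs_of_pos hr, ← Real.norm_eq_abs, ← dist_smul₀, Real.norm_eq_abs, abs_of_pos hr,
        smul_inv_smul₀ hr.ne']
    simp only [mem_ofPred_eq, this]
    exact (mul_le_mul_iff_right₀ hr).symm
  rw [hS] at h
  have h2 : ∀ z, (f (r • x) - f (r • z)) / dist x z ^ ((n : ℝ) + 2 * σ) =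
      r ^ ((n : ℝ) + 2 * σ) *
        ((f (r • x) - f (r • z)) / dist (r • x) (r • z) ^ ((n : ℝ) + 2 * σ)) := by
    intro z
    rw [dist_smul₀, Real.norm_eq_abs, abs_of_pos hr, Real.mul_rpow hr.le dist_nonneg]
    field_simp
  rw [truncInt, truncInt]
  simp only [h2]
  rw [integral_const_mul, h, finrank_euclideanSpace_fin, smul_eq_mul, ← mul_assoc,
    Real.rpow_add hr, Real.rpow_natCast]
  field_simp

lemma fracLap_comp_smul {n : ℕ} (hn : 1 ≤ n) {σ : ℝ} (hσ : 0 < σ) (hσ1 : σ < 1)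
    {f : En n → ℝ} (hf : ContDiff ℝ 2 f) (hc : HasCompactSupport f) {r : ℝ} (hr : 0 < r)
    (x : En n) :
    fracLap n σ (fun y => f (r • y)) x = r ^ (2 * σ) * fracLap n σ f (r • x) := by
  obtain ⟨L, hL⟩ := exists_tendsto_truncInt hn hσ hσ1 hf hc (r • x)
  have h0 : Tendsto (fun ε : ℝ => r * ε) (nhdsWithin 0 (Ioi 0)) (nhdsWithin 0 (Ioi 0)) := by
    refine tendsto_nhdsWithin_iff.2 ⟨?_, ?_⟩
    · have : Tendsto (fun ε : ℝ => r * ε) (nhds 0) (nhds (r * 0)) :=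
        (continuous_const_mul r).tendsto 0
      rw [mul_zero] at this
      exact this.mono_left nhdsWithin_le_nhds
    · filter_upwards [self_mem_nhdsWithin] with ε hε using mul_pos hr hε
  have h1 : Tendsto (truncInt n σ (fun y => f (r • y)) x) (nhdsWithin 0 (Ioi 0))
      (nhds (r ^ (2 * σ) * L)) := by
    simp only [funext (truncInt_comp_smul σ f hr x)]
    exact (hL.comp h0).const_mul _
  rw [fracLap_eq_of_tendsto h1, fracLap_eq_of_tendsto hL]
  ring

lemma truncInt_sum {n : ℕ} {σ : ℝ} (hσ : 0 < σ) {ι : Type*} (s : Finset ι) {f : ι → En n → ℝ}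
    (hf : ∀ i, Continuous (f i)) {M : ι → ℝ} (hM : ∀ i x, |f i x| ≤ M i) (c : ι → ℝ)
    (x : En n) {ε : ℝ} (hε : 0 < ε) :
    truncInt n σ (fun y => ∑ i ∈ s, c i * f i y) x ε = ∑ i ∈ s, c i * truncInt n σ (f i) x ε := by
  simp only [truncInt_eq, ← integral_const_mul]
  rw [← integral_finsetSum]
  · refine integral_congr_ae (Eventually.of_forall fun z => ?_)
    simp only [← Finset.sum_sub_distrib, Finset.sum_mul]
    exact Finset.sum_congr rfl fun i _ => by ring
  · exact fun i _ => (integrableOn_truncInt hσ (hf i) (hM i) x hε).const_mul _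

lemma truncInt_convolution {n : ℕ} {σ : ℝ} (hσ : 0 < σ) (ν : Measure (En n)) [IsFiniteMeasure ν]
    {k : En n → ℝ} (hk : Continuous k) {M : ℝ} (hM : ∀ x, |k x| ≤ M) (x : En n)
    {ε : ℝ} (hε : 0 < ε) :
    truncInt n σ (fun y => ∫ t, k (y - t) ∂ν) x ε = ∫ t, truncInt n σ k (x - t) ε ∂ν := by
  have hki : ∀ y, Integrable (fun t => k (y - t)) ν := fun y =>
    Integrable.of_bound (Continuous.aestronglyMeasurable (by fun_prop)) M
      (Eventually.of_forall fun t => hM _)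
  simp only [truncInt_eq]
  rw [integral_integral_swap]
  · refine integral_congr_ae (Eventually.of_forall fun z => ?_)
    simp only
    rw [integral_mul_const, integral_sub]
    · congr 3; ext t; congr 1; abel
    · exact hki x
    · exact (hki (x - z)).congr (Eventually.of_forall fun t => by simp only; congr 1; abel)
  · have h1 : Integrable (fun p : En n × En n => (1 : ℝ) * ‖p.2‖ ^ (-((n : ℝ) + 2 * σ)))
        (ν.prod (volume.restrict (ball (0 : En n) ε)ᶜ)) :=
      Integrable.mul_prod (f := fun _ => (1 : ℝ)) (integrable_const _)
        (integrableOn_compl_ball_rpow (by linarith) hε)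
    simp only [one_mul] at h1
    refine Integrable.bdd_mul (c := 2 * M) h1 ?_ ?_
    · exact Continuous.aestronglyMeasurable (by fun_prop)
    · refine Eventually.of_forall fun z => ?_
      rw [Real.norm_eq_abs]
      have h1 := abs_le.1 (hM (x - z.1))
      have h2 := abs_le.1 (hM (x - z.1 - z.2))
      exact abs_le.2 ⟨by linarith, by linarith⟩

/-- A smooth bump equal to `1` on the ball of radius `1/2` and supported in the unit ball. -/
def unitBump (n : ℕ) : ContDiffBump (0 : En n) := ⟨1 / 2, 1, by norm_num, by norm_num⟩

/-- A smooth truncation at scales between `2^{-N} τ` and `τ` of the kernel `‖x‖^{-a}`. -/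
def dyadicKer (n : ℕ) (a τ : ℝ) (N : ℕ) (x : En n) : ℝ :=
  ∑ j ∈ Finset.range N, (2 ^ j / τ) ^ a * unitBump n ((2 ^ j / τ : ℝ) • x)

lemma contDiff_dyadicKer (n : ℕ) (a τ : ℝ) (N : ℕ) {m : ℕ∞} :
    ContDiff ℝ m (dyadicKer n a τ N) := by
  unfold dyadicKer
  refine ContDiff.sum fun j _ => contDiff_const.mul ?_
  exact (unitBump n).contDiff.comp (contDiff_const_smul _)

lemma dyadicKer_nonneg (n : ℕ) (a : ℝ) {τ : ℝ} (hτ : 0 < τ) (N : ℕ) (x : En n) :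
    0 ≤ dyadicKer n a τ N x :=
  Finset.sum_nonneg fun j _ => mul_nonneg (by positivity) (unitBump n).nonneg

lemma dyadicKer_eq_zero (n : ℕ) (a : ℝ) {τ : ℝ} (hτ : 0 < τ) (N : ℕ) {x : En n}
    (hx : τ ≤ ‖x‖) : dyadicKer n a τ N x = 0 := by
  refine Finset.sum_eq_zero fun j _ => ?_
  rw [(unitBump n).zero_of_le_dist, mul_zero]
  change (1 : ℝ) ≤ _
  rw [dist_zero_right, norm_smul, Real.norm_eq_abs, abs_of_pos (by positivity), div_mul_eq_mul_div,
    le_div_iff₀ hτ, one_mul]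
  have : (1 : ℝ) ≤ 2 ^ j := one_le_pow₀ (by norm_num)
  nlinarith

lemma hasCompactSupport_dyadicKer (n : ℕ) (a : ℝ) {τ : ℝ} (hτ : 0 < τ) (N : ℕ) :
    HasCompactSupport (dyadicKer n a τ N) := by
  refine HasCompactSupport.intro (isCompact_closedBall (0 : En n) τ) fun x hx => ?_
  refine dyadicKer_eq_zero n a hτ N ?_
  rw [mem_closedBall_zero_iff] at hx
  exact (not_le.1 hx).le

lemma rpow_le_dyadicKer (n : ℕ) {a : ℝ} (ha : 0 < a) {τ : ℝ} (hτ : 0 < τ) (N : ℕ) {x : En n}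
    (h1 : τ * (1 / 2) ^ N ≤ ‖x‖) (h2 : ‖x‖ ≤ τ / 2) :
    ‖x‖ ^ (-a) ≤ 4 ^ a * dyadicKer n a τ N x := by
  have hx : 0 < ‖x‖ := lt_of_lt_of_le (by positivity) h1
  obtain ⟨j, hj1, hj2⟩ := exists_nat_pow_near (x := τ / (2 * ‖x‖)) (y := (2 : ℝ))
    (by rw [le_div_iff₀ (by positivity)]; linarith) (by norm_num)
  rw [le_div_iff₀ (by positivity)] at hj1
  rw [div_lt_iff₀ (by positivity)] at hj2
  have hjN : j < N := by
    have : (2 : ℝ) ^ j < 2 ^ N := by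
      have h3 : τ ≤ 2 ^ N * ‖x‖ := by
        rw [one_div, inv_pow, ← div_eq_mul_inv, div_le_iff₀ (by positivity)] at h1
        linarith
      by_contra hcon
      push Not at hcon
      have : (2 : ℝ) ^ N * ‖x‖ ≤ 2 ^ j * ‖x‖ := by gcongr
      nlinarith
    exact (pow_lt_pow_iff_right₀ (by norm_num : (1 : ℝ) < 2)).1 this
  have hone : unitBump n ((2 ^ j / τ : ℝ) • x) = 1 := by
    refine (unitBump n).one_of_mem_closedBall ?_
    rw [mem_closedBall_zero_iff, norm_smul, Real.norm_eq_abs, abs_of_pos (by positivity)]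
    change _ ≤ (1 / 2 : ℝ)
    rw [div_mul_eq_mul_div, div_le_iff₀ hτ]
    linarith
  have hterm : (2 ^ j / τ) ^ a ≤ dyadicKer n a τ N x := by
    have := Finset.single_le_sum
      (f := fun j => (2 ^ j / τ) ^ a * unitBump n ((2 ^ j / τ : ℝ) • x))
      (fun i _ => mul_nonneg (by positivity) (unitBump n).nonneg) (Finset.mem_range.2 hjN)
    simp only [hone, mul_one] at this
    exact this
  refine le_trans ?_ (mul_le_mul_of_nonneg_left hterm (by positivity))
  rw [← Real.mul_rpow (by norm_num) (by positivity), Real.rpow_neg hx.le, ← Real.inv_rpow hx.le]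
  refine Real.rpow_le_rpow (by positivity) ?_ ha.le
  rw [inv_eq_one_div, div_le_iff₀ hx, mul_div_assoc', div_mul_eq_mul_div, le_div_iff₀ hτ]
  rw [pow_succ] at hj2
  linarith

lemma sum_dyadic_min_le {t : ℝ} (ht : 0 < t) (N : ℕ) :
    ∑ j ∈ Finset.range N, min (2 ^ j * t) (2 ^ j * t)⁻¹ ≤ 6 := by
  have hstep : ∀ X : ℝ, 0 < X → min X X⁻¹ ≤ 6 * (2 * X / (1 + 2 * X) - X / (1 + X)) := by
    intro X hX
    have e : 2 * X / (1 + 2 * X) - X / (1 + X) = X / ((1 + X) * (1 + 2 * X)) := by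
      field_simp; ring
    rw [e, mul_div_assoc', le_div_iff₀ (by positivity)]
    rcases le_total X 1 with h | h
    · calc _ ≤ X * ((1 + X) * (1 + 2 * X)) := by gcongr; exact min_le_left _ _
        _ ≤ _ := by nlinarith [mul_nonneg hX.le hX.le, mul_pos hX hX]
    · calc _ ≤ X⁻¹ * ((1 + X) * (1 + 2 * X)) := by gcongr; exact min_le_right _ _
        _ ≤ _ := by
          rw [inv_mul_le_iff₀ hX]
          nlinarith
  have hsum : ∑ j ∈ Finset.range N, min (2 ^ j * t) (2 ^ j * t)⁻¹ ≤
      ∑ j ∈ Finset.range N, ((fun j : ℕ => 6 * (2 ^ j * t / (1 + 2 ^ j * t))) (j + 1) -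
        (fun j : ℕ => 6 * (2 ^ j * t / (1 + 2 ^ j * t))) j) := by
    refine Finset.sum_le_sum fun j _ => ?_
    refine (hstep (2 ^ j * t) (by positivity)).trans (le_of_eq ?_)
    simp only [pow_succ]
    ring_nf
  rw [Finset.sum_range_sub (fun j : ℕ => 6 * (2 ^ j * t / (1 + 2 ^ j * t))) N] at hsum
  refine hsum.trans ?_
  have h1 : 2 ^ N * t / (1 + 2 ^ N * t) ≤ 1 := by
    rw [div_le_one (by positivity)]; linarith
  have h2 : 0 ≤ (2 : ℝ) ^ 0 * t / (1 + 2 ^ 0 * t) := by positivity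
  linarith

/-- Uniformly in the truncation, `(-Δ)^{s/2}` of the truncated kernel `‖x‖^{2s-n}` is
`O(‖x‖^{s-n})`. -/
lemma exists_abs_truncInt_dyadicKer_le {n : ℕ} {s : ℝ} (hs : 1 < s) (hs2 : s < 2)
    (hn : 2 * s < n) : ∃ B, 0 < B ∧ ∀ (τ : ℝ) (N : ℕ) (x : En n) (ε : ℝ), 0 < τ → 0 < ε → x ≠ 0 →
      |truncInt n (s / 2) (dyadicKer n (n - 2 * s) τ N) x ε| ≤ B * ‖x‖ ^ (-((n : ℝ) - s)) := by
  have hn1 : 1 ≤ n := by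
    have : (1 : ℝ) ≤ n := by linarith
    exact_mod_cast this
  obtain ⟨B, hB0, hB⟩ := exists_abs_truncInt_le_rpow hn1 (σ := s / 2) (by linarith) (by linarith)
    (f := unitBump n) (unitBump n).contDiff (unitBump n).hasCompactSupport
  refine ⟨6 * B + 1, by positivity, fun τ N x ε hτ hε hx => ?_⟩
  have hx0 : 0 < ‖x‖ := norm_pos_iff.2 hx
  have hsum := truncInt_sum (σ := s / 2) (by linarith) (Finset.range N)
    (f := fun j y => unitBump n ((2 ^ j / τ : ℝ) • y)) (M := fun _ => 1)
    (fun j => (unitBump n).continuous.comp (continuous_const_smul _))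
    (fun j y => abs_le.2 ⟨by linarith [(unitBump n).nonneg (x := (2 ^ j / τ : ℝ) • y)],
      (unitBump n).le_one⟩) (fun j : ℕ => (2 ^ j / τ) ^ ((n : ℝ) - 2 * s)) x hε
  have heq : truncInt n (s / 2) (dyadicKer n (n - 2 * s) τ N) x ε = _ := hsum
  rw [heq]
  refine (Finset.abs_sum_le_sum_abs _ _).trans ?_
  have hterm : ∀ j ∈ Finset.range N, |(2 ^ j / τ) ^ ((n : ℝ) - 2 * s) *
      truncInt n (s / 2) (fun y => unitBump n ((2 ^ j / τ : ℝ) • y)) x ε| ≤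
      B * ‖x‖ ^ (-((n : ℝ) - s)) * min (2 ^ j * (‖x‖ / τ)) (2 ^ j * (‖x‖ / τ))⁻¹ := by
    intro j _
    have hθ : (0 : ℝ) < 2 ^ j / τ := by positivity
    have hX : 2 ^ j * (‖x‖ / τ) = 2 ^ j / τ * ‖x‖ := by ring
    rw [truncInt_comp_smul (s / 2) (unitBump n) hθ, hX]
    have hb := hB ((2 ^ j / τ : ℝ) • x) (2 ^ j / τ * ε) (by positivity)
    have hb2 := hb.2 (smul_ne_zero hθ.ne' hx)
    rw [norm_smul, Real.norm_eq_abs, abs_of_pos hθ] at hb2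
    generalize (2 ^ j / τ : ℝ) = θ at hθ hb hb2 ⊢
    set X := θ * ‖x‖ with hXd
    have hX0 : 0 < X := by positivity
    rw [abs_mul, abs_mul, abs_of_nonneg (by positivity : (0 : ℝ) ≤ θ ^ ((n : ℝ) - 2 * s)),
      abs_of_nonneg (by positivity : (0 : ℝ) ≤ θ ^ (2 * (s / 2))), ← mul_assoc,
      ← Real.rpow_add hθ]
    have e1 : (n : ℝ) - 2 * s + 2 * (s / 2) = n - s := by ring
    have e2 : θ ^ ((n : ℝ) - s) = ‖x‖ ^ (-((n : ℝ) - s)) * X ^ ((n : ℝ) - s) := by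
      rw [hXd, Real.mul_rpow hθ.le hx0.le, Real.rpow_neg hx0.le]; field_simp
    rw [e1, e2]
    have hp : 0 ≤ ‖x‖ ^ (-((n : ℝ) - s)) := by positivity
    have main : X ^ ((n : ℝ) - s) *
        |truncInt n (s / 2) (unitBump n) (θ • x) (θ * ε)| ≤ B * min X X⁻¹ := by
      rcases le_total X 1 with h | h
      · have h3 : X ≤ X⁻¹ := h.trans ((one_le_inv₀ hX0).2 h)
        rw [min_eq_left h3, mul_comm B]
        refine mul_le_mul ?_ hb.1 (abs_nonneg _) hX0.le
        calc X ^ ((n : ℝ) - s) ≤ X ^ (1 : ℝ) :=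
              Real.rpow_le_rpow_of_exponent_ge hX0 h (by linarith)
          _ = X := Real.rpow_one X
      · have h3 : X⁻¹ ≤ X := (inv_le_one_of_one_le₀ h).trans h
        rw [min_eq_right h3]
        calc _ ≤ X ^ ((n : ℝ) - s) * (B * X ^ (-((n : ℝ) + 2 * (s / 2)))) := by gcongr
          _ = B * (X ^ ((n : ℝ) - s) * X ^ (-((n : ℝ) + 2 * (s / 2)))) := by ring
          _ = B * X ^ (-(2 * s)) := by rw [← Real.rpow_add hX0]; congr 2; ring
          _ ≤ B * X ^ (-1 : ℝ) := by
            gcongr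
            · linarith
          _ = B * X⁻¹ := by rw [Real.rpow_neg_one]
    calc _ = ‖x‖ ^ (-((n : ℝ) - s)) * (X ^ ((n : ℝ) - s) *
        |truncInt n (s / 2) (unitBump n) (θ • x) (θ * ε)|) := by ring
      _ ≤ ‖x‖ ^ (-((n : ℝ) - s)) * (B * min X X⁻¹) := by gcongr
      _ = _ := by ring
  refine (Finset.sum_le_sum hterm).trans ?_
  rw [← Finset.mul_sum]
  have h6 := sum_dyadic_min_le (t := ‖x‖ / τ) (by positivity) N
  have hp : 0 ≤ ‖x‖ ^ (-((n : ℝ) - s)) := by positivity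
  calc _ ≤ B * ‖x‖ ^ (-((n : ℝ) - s)) * 6 := by gcongr
    _ ≤ _ := by nlinarith

lemma lintegral_sq_lintegral_rieszKer_le {n : ℕ} {p : ℝ} {C : ENNReal}
    (hC : ∀ y z : En n, ∫⁻ x, rieszKer p (x - y) * rieszKer p (x - z) ≤
      C * rieszKer (2 * p - n) (y - z)) (ν : Measure (En n)) [IsFiniteMeasure ν] :
    ∫⁻ x, (∫⁻ t, rieszKer p (x - t) ∂ν) ^ 2 ≤
      C * ∫⁻ y, ∫⁻ z, rieszKer (2 * p - n) (y - z) ∂ν ∂ν := by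
  have hm := measurable_rieszKer (n := n) p
  have hm2 := measurable_rieszKer (n := n) (2 * p - n)
  have e1 : ∀ x : En n, (∫⁻ t, rieszKer p (x - t) ∂ν) ^ 2 =
      ∫⁻ y, ∫⁻ z, rieszKer p (x - y) * rieszKer p (x - z) ∂ν ∂ν := by
    intro x
    have : ∀ y, ∫⁻ z, rieszKer p (x - y) * rieszKer p (x - z) ∂ν =
        rieszKer p (x - y) * ∫⁻ z, rieszKer p (x - z) ∂ν := fun y =>
      lintegral_const_mul _ (by fun_prop)
    simp only [this]
    rw [lintegral_mul_const _ (by fun_prop), sq]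
  simp only [e1]
  rw [lintegral_lintegral_swap
    (Measurable.aemeasurable (Measurable.lintegral_prod_right' (ν := ν)
      (f := fun q : (En n × En n) × En n => rieszKer p (q.1.1 - q.1.2) * rieszKer p (q.1.1 - q.2))
      (by fun_prop)))]
  have hmm : Measurable fun y : En n => ∫⁻ z, rieszKer (2 * p - n) (y - z) ∂ν :=
    Measurable.lintegral_prod_right' (ν := ν)
      (f := fun q : En n × En n => rieszKer (2 * p - n) (q.1 - q.2)) (by fun_prop)
  rw [← lintegral_const_mul _ hmm]
  refine lintegral_mono fun y => ?_
  rw [lintegral_lintegral_swap (Measurable.aemeasurable (by fun_prop)),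
    ← lintegral_const_mul _ (by fun_prop)]
  exact lintegral_mono fun z => hC y z

/-- The truncated Riesz potential of a measure. -/
def truncPot (n : ℕ) (a τ : ℝ) (N : ℕ) (ν : Measure (En n)) (x : En n) : ℝ :=
  ∫ t, dyadicKer n a τ N (x - t) ∂ν

lemma contDiff_truncPot (n : ℕ) (a : ℝ) {τ : ℝ} (hτ : 0 < τ) (N : ℕ) (ν : Measure (En n))
    [IsFiniteMeasure ν] : ContDiff ℝ (⊤ : ℕ∞) (truncPot n a τ N ν) := by
  have h := HasCompactSupport.contDiff_convolution_right (μ := ν) (n := (⊤ : ℕ∞))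
    (ContinuousLinearMap.lsmul ℝ ℝ) (f := fun _ : En n => (1 : ℝ)) (g := dyadicKer n a τ N)
    (hasCompactSupport_dyadicKer n a hτ N) (integrable_const (1 : ℝ)).locallyIntegrable
    (contDiff_dyadicKer n a τ N)
  have e : truncPot n a τ N ν = convolution (fun _ : En n => (1 : ℝ)) (dyadicKer n a τ N)
      (ContinuousLinearMap.lsmul ℝ ℝ) ν := by
    funext x
    simp [truncPot, convolution]
  rwa [e]

lemma truncPot_nonneg (n : ℕ) (a : ℝ) {τ : ℝ} (hτ : 0 < τ) (N : ℕ) (ν : Measure (En n))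
    (x : En n) : 0 ≤ truncPot n a τ N ν x :=
  integral_nonneg fun _ => dyadicKer_nonneg n a hτ N _

lemma truncPot_eq_zero (n : ℕ) (a : ℝ) {τ : ℝ} (hτ : 0 < τ) (N : ℕ) {ν : Measure (En n)}
    {x : En n} (h : ∀ᵐ t ∂ν, τ ≤ ‖x - t‖) : truncPot n a τ N ν x = 0 := by
  refine integral_eq_zero_of_ae ?_
  filter_upwards [h] with t ht using dyadicKer_eq_zero n a hτ N ht

lemma tsupport_truncPot_subset (n : ℕ) (a : ℝ) {τ : ℝ} (hτ : 0 < τ) (N : ℕ) {ν : Measure (En n)}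
    {r₁ r₂ : ℝ} (h : ∀ᵐ t ∂ν, r₁ ≤ ‖t‖ ∧ ‖t‖ ≤ r₂) :
    tsupport (truncPot n a τ N ν) ⊆ {x | r₁ - τ ≤ ‖x‖ ∧ ‖x‖ ≤ r₂ + τ} := by
  refine closure_minimal (fun x hx => ?_)
    ((isClosed_le continuous_const continuous_norm).inter
      (isClosed_le continuous_norm continuous_const))
  by_contra hcon
  refine hx (truncPot_eq_zero n a hτ N ?_)
  filter_upwards [h] with t ht
  have h1 : ‖t‖ - ‖x‖ ≤ ‖x - t‖ := by rw [norm_sub_rev]; exact norm_sub_norm_le t x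
  have h2 : ‖x‖ - ‖t‖ ≤ ‖x - t‖ := norm_sub_norm_le x t
  by_contra hlt
  push Not at hlt
  exact hcon ⟨by linarith, by linarith⟩

/-- The energy `∫ |(-Δ)^{s/2} φ|²` of a truncated Riesz potential is controlled by the mutual
energy of the measure. -/
lemma exists_lintegral_fracLap_truncPot_sq_le {n : ℕ} {s : ℝ} (hs : 1 < s) (hs2 : s < 2)
    (hn : 2 * s < n) : ∃ D : ENNReal, D ≠ ⊤ ∧ ∀ (τ : ℝ) (N : ℕ) (ν : Measure (En n))
      [IsFiniteMeasure ν], 0 < τ → HasCompactSupport (truncPot n (n - 2 * s) τ N ν) →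
      ∫⁻ x, ‖fracLap n (s / 2) (truncPot n (n - 2 * s) τ N ν) x‖ₑ ^ 2 ≤
        D * ∫⁻ y, ∫⁻ z, rieszKer ((n : ℝ) - 2 * s) (y - z) ∂ν ∂ν := by
  have hn1 : 1 ≤ n := by
    have : (1 : ℝ) ≤ n := by linarith
    exact_mod_cast this
  obtain ⟨B, hB0, hB⟩ := exists_abs_truncInt_dyadicKer_le hs hs2 hn
  obtain ⟨C, hC, hCle⟩ := exists_lintegral_rieszKer_mul_le hn1 (p := (n : ℝ) - s)
    (by linarith) (by linarith)
  have hexp : 2 * ((n : ℝ) - s) - n = n - 2 * s := by ring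
  refine ⟨(‖cFrac n (s / 2)‖ₑ * ENNReal.ofReal B) ^ 2 * C,
    ENNReal.mul_ne_top (ENNReal.pow_ne_top (ENNReal.mul_ne_top enorm_ne_top
      ENNReal.ofReal_ne_top)) hC, fun τ N ν _ hτ hc => ?_⟩
  obtain ⟨M, -, hM⟩ := (hasCompactSupport_dyadicKer n ((n : ℝ) - 2 * s) hτ N).exists_abs_le
    (contDiff_dyadicKer n ((n : ℝ) - 2 * s) τ N (m := 0)).continuous
  have hpt : ∀ x, ‖fracLap n (s / 2) (truncPot n (n - 2 * s) τ N ν) x‖ₑ ^ 2 ≤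
      (‖cFrac n (s / 2)‖ₑ * ENNReal.ofReal B) ^ 2 *
        (∫⁻ t, rieszKer ((n : ℝ) - s) (x - t) ∂ν) ^ 2 := by
    intro x
    rw [← mul_pow, mul_assoc]
    gcongr
    refine enorm_fracLap_le hn1 (by linarith) (by linarith)
      (contDiff_infty.1 (contDiff_truncPot n _ hτ N ν) 2) hc fun ε hε => ?_
    have e : truncInt n (s / 2) (truncPot n (n - 2 * s) τ N ν) x ε = _ :=
      truncInt_convolution (by linarith) ν
        (contDiff_dyadicKer n ((n : ℝ) - 2 * s) τ N (m := 0)).continuous hM x hε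
    rw [e]
    refine (enorm_integral_le_lintegral_enorm _).trans ?_
    have hmx : Measurable fun t : En n => rieszKer ((n : ℝ) - s) (x - t) :=
      (measurable_rieszKer _).comp (by fun_prop)
    rw [← lintegral_const_mul _ hmx]
    refine lintegral_mono fun t => ?_
    by_cases hxt : x - t = 0
    · have htop : rieszKer ((n : ℝ) - s) (x - t) = ⊤ := by
        rw [rieszKer, hxt, enorm_zero, ENNReal.zero_rpow_of_neg (by linarith)]
      dsimp only
      rw [htop, ENNReal.mul_top (by simpa using hB0)]
      exact le_top
    · dsimp only
      rw [rieszKer_of_ne _ hxt, ← ENNReal.ofReal_mul hB0.le, Real.enorm_eq_ofReal_abs]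
      exact ENNReal.ofReal_le_ofReal (hB τ N (x - t) ε hτ hε hxt)
  refine (lintegral_mono hpt).trans ?_
  have hmm : Measurable fun x : En n => ∫⁻ t, rieszKer ((n : ℝ) - s) (x - t) ∂ν :=
    Measurable.lintegral_prod_right' (ν := ν)
      (f := fun q : En n × En n => rieszKer ((n : ℝ) - s) (q.1 - q.2))
      ((measurable_rieszKer _).comp (by fun_prop))
  rw [lintegral_const_mul _ (hmm.pow_const 2), mul_assoc]
  gcongr
  have := lintegral_sq_lintegral_rieszKer_le hCle ν
  rwa [hexp] at this

lemma lintegral_rieszKer_le_truncPot {n : ℕ} {a : ℝ} (ha : 0 < a) {τ : ℝ} (hτ : 0 < τ) (N : ℕ)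
    (ν : Measure (En n)) [IsFiniteMeasure ν] {G : ENNReal} (hG : ν ≤ G • volume) (x : En n) :
    ∫⁻ z, rieszKer a (x - z) ∂ν ≤
      G * (∫⁻ z in ball (0 : En n) (τ * (1 / 2) ^ N), rieszKer a z) +
        ENNReal.ofReal (4 ^ a * truncPot n a τ N ν x) +
        ENNReal.ofReal ((τ / 2) ^ (-a)) * ν univ := by
  have hm := measurable_rieszKer (n := n) a
  have hcont : Continuous (dyadicKer n a τ N) :=
    (contDiff_dyadicKer n a τ N (m := 0)).continuous
  obtain ⟨M, -, hM⟩ := (hasCompactSupport_dyadicKer n a hτ N).exists_abs_le hcont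
  set ρ := τ * (1 / 2) ^ N with hρ
  have hρ0 : 0 < ρ := by positivity
  have hpt : ∀ z, rieszKer a (x - z) ≤ (ball (0 : En n) ρ).indicator (rieszKer a) (x - z) +
      ENNReal.ofReal (4 ^ a * dyadicKer n a τ N (x - z)) + ENNReal.ofReal ((τ / 2) ^ (-a)) := by
    intro z
    by_cases h1 : x - z ∈ ball (0 : En n) ρ
    · rw [indicator_of_mem h1, add_assoc]
      exact le_self_add
    · rw [indicator_of_notMem h1, zero_add]
      rw [mem_ball_zero_iff, not_lt] at h1
      rcases le_total ‖x - z‖ (τ / 2) with h2 | h2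
      · refine le_trans ?_ le_self_add
        rw [rieszKer_of_ne _ (norm_pos_iff.1 (hρ0.trans_le h1))]
        exact ENNReal.ofReal_le_ofReal (rpow_le_dyadicKer n ha hτ N h1 h2)
      · exact (rieszKer_anti ha.le (by positivity) h2).trans le_add_self
  have hmi : Measurable fun z : En n => (ball (0 : En n) ρ).indicator (rieszKer a) (x - z) :=
    (hm.indicator measurableSet_ball).comp (by fun_prop)
  have hmd : Measurable fun z : En n => ENNReal.ofReal (4 ^ a * dyadicKer n a τ N (x - z)) := by
    have := hcont.measurable
    fun_prop
  refine (lintegral_mono hpt).trans ?_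
  rw [lintegral_add_right _ measurable_const, lintegral_add_left hmi, lintegral_const]
  gcongr
  · refine (lintegral_mono' hG le_rfl).trans ?_
    rw [lintegral_smul_measure, lintegral_sub_left_eq_self
      ((ball (0 : En n) ρ).indicator (rieszKer a)) x, lintegral_indicator measurableSet_ball,
      smul_eq_mul]
  · rw [truncPot, ← integral_const_mul, ofReal_integral_eq_lintegral_ofReal]
    · refine Integrable.const_mul ?_ _
      exact Integrable.of_bound (Continuous.aestronglyMeasurable (by fun_prop)) M
        (Eventually.of_forall fun t => hM _)
    · exact Eventually.of_forall fun z =>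
        mul_nonneg (by positivity) (dyadicKer_nonneg n a hτ N _)

/-- The measure `e^g dx`. -/
def expMeasure {n : ℕ} (g : En n → ℝ) : Measure (En n) :=
  volume.withDensity fun x => ENNReal.ofReal (Real.exp (g x))

lemma lintegral_expMeasure {n : ℕ} {g : En n → ℝ} (hg : Continuous g) {f : En n → ENNReal}
    (hf : Measurable f) :
    ∫⁻ x, f x ∂expMeasure g = ∫⁻ x, ENNReal.ofReal (Real.exp (g x)) * f x :=
  lintegral_withDensity_eq_lintegral_mul _ (by fun_prop) hf

lemma exists_expMeasure_restrict_le {n : ℕ} {g : En n → ℝ} (hg : Continuous g) {K : Set (En n)}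
    (hK : IsCompact K) : ∃ G : ENNReal, G ≠ ⊤ ∧ (expMeasure g).restrict K ≤ G • volume := by
  obtain ⟨M, hM⟩ := (hK.image hg).bddAbove
  refine ⟨ENNReal.ofReal (Real.exp M), ENNReal.ofReal_ne_top, ?_⟩
  rw [expMeasure, restrict_withDensity hK.measurableSet, ← withDensity_const]
  refine Measure.le_iff.2 fun A hA => ?_
  rw [withDensity_apply _ hA, withDensity_apply _ hA, Measure.restrict_restrict hA, inter_comm]
  refine (setLIntegral_mono (by fun_prop) fun x hx => ?_).trans
    (lintegral_mono_set inter_subset_right)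
  exact ENNReal.ofReal_le_ofReal (Real.exp_le_exp.2 (hM (mem_image_of_mem g hx.1)))

lemma expMeasure_lt_top {n : ℕ} {g : En n → ℝ} (hg : Continuous g) {K : Set (En n)}
    (hK : IsCompact K) : expMeasure g K < ⊤ := by
  obtain ⟨G, hG, hGle⟩ := exists_expMeasure_restrict_le hg hK
  have := hGle K
  rw [Measure.restrict_apply_self, Measure.smul_apply, smul_eq_mul] at this
  exact this.trans_lt (ENNReal.mul_lt_top hG.lt_top hK.measure_lt_top)

lemma exists_lintegral_ball_rieszKer_le {n : ℕ} (hn : 1 ≤ n) {a τ : ℝ} (ha : a < n) (hτ : 0 < τ)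
    {G : ENNReal} (hG : G ≠ ⊤) :
    ∃ N : ℕ, G * (∫⁻ z in ball (0 : En n) (τ * (1 / 2) ^ N), rieszKer a z) ≤ 1 := by
  have hI := lintegral_unitBall_rieszKer_lt_top hn ha
  have hb : 0 < (n : ℝ) - a := by linarith
  have h1 : Tendsto (fun N : ℕ => τ * (1 / 2 : ℝ) ^ N) atTop (nhds (τ * 0)) :=
    (tendsto_pow_atTop_nhds_zero_of_lt_one (by norm_num) (by norm_num)).const_mul τ
  rw [mul_zero] at h1
  have h2 := h1.rpow_const (p := (n : ℝ) - a) (Or.inr hb.le)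
  rw [Real.zero_rpow hb.ne'] at h2
  have h3 := ENNReal.tendsto_ofReal h2
  rw [ENNReal.ofReal_zero] at h3
  have h4 := ENNReal.Tendsto.const_mul (a := G) (ENNReal.Tendsto.mul_const
    (b := ∫⁻ x in ball (0 : En n) 1, rieszKer a x) h3 (Or.inr hI.ne)) (Or.inr hG)
  rw [zero_mul, mul_zero] at h4
  obtain ⟨N, hN⟩ := (h4.eventually (eventually_le_nhds one_pos)).exists
  exact ⟨N, by rwa [lintegral_ball_rieszKer a (by positivity)]⟩

lemma StableOutsideBall.ofReal_integral_sq_le {n : ℕ} {s R : ℝ} {g φ : En n → ℝ}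
    (hst : StableOutsideBall n s g R) (hg : Continuous g)
    (hφ : TestOn n (closedBall (0 : En n) R)ᶜ φ) {ν : Measure (En n)} [IsFiniteMeasure ν]
    (hν : ν ≤ expMeasure g) :
    ENNReal.ofReal (∫ x, φ x ^ 2 ∂ν) ≤ ∫⁻ x, ‖fracLap n (s / 2) φ x‖ₑ ^ 2 := by
  have hφc : Continuous φ := hφ.1.continuous
  have hcs : HasCompactSupport fun x => φ x ^ 2 :=
    hφ.2.1.comp_left (g := fun t : ℝ => t ^ 2) (by simp)
  have hgi : Integrable fun x => Real.exp (g x) * φ x ^ 2 :=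
    (Continuous.mul (by fun_prop) (hφc.pow 2)).integrable_of_hasCompactSupport hcs.mul_left
  calc ENNReal.ofReal (∫ x, φ x ^ 2 ∂ν) = ∫⁻ x, ENNReal.ofReal (φ x ^ 2) ∂ν :=
        ofReal_integral_eq_lintegral_ofReal ((hφc.pow 2).integrable_of_hasCompactSupport hcs)
          (Eventually.of_forall fun x => sq_nonneg _)
    _ ≤ ∫⁻ x, ENNReal.ofReal (φ x ^ 2) ∂expMeasure g := lintegral_mono' hν le_rfl
    _ = ∫⁻ x, ENNReal.ofReal (Real.exp (g x) * φ x ^ 2) := by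
        rw [lintegral_expMeasure hg (by fun_prop)]
        exact lintegral_congr fun x => (ENNReal.ofReal_mul (Real.exp_nonneg _)).symm
    _ = ENNReal.ofReal (∫ x, Real.exp (g x) * φ x ^ 2) :=
        (ofReal_integral_eq_lintegral_ofReal hgi (Eventually.of_forall fun x => by
          dsimp only [Pi.zero_apply]; positivity)).symm
    _ ≤ ENNReal.ofReal (∫ x, fracLap n (s / 2) φ x ^ 2) := ENNReal.ofReal_le_ofReal (hst φ hφ)
    _ ≤ ∫⁻ x, ‖fracLap n (s / 2) φ x ^ 2‖ₑ :=
        (Real.ofReal_le_enorm _).trans (enorm_integral_le_lintegral_enorm _)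
    _ = ∫⁻ x, ‖fracLap n (s / 2) φ x‖ₑ ^ 2 := by simp only [enorm_pow]

lemma integral_sq_le_of_le_integral {n : ℕ} {ν : Measure (En n)} [IsFiniteMeasure ν]
    {φ : En n → ℝ} (hφi : Integrable φ ν) (hφ2i : Integrable (fun x => φ x ^ 2) ν)
    {D b k : ℝ} (hk : 0 ≤ k)
    (h : ∫ x, φ x ^ 2 ∂ν ≤ D * ∫ x, (1 + b * φ x + k * ν.real univ) ∂ν) :
    ∫ x, φ x ^ 2 ∂ν ≤ (2 * D + (D * b) ^ 2) * (ν.real univ + k * ν.real univ ^ 2) := by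
  have hm0 : 0 ≤ ν.real univ := measureReal_nonneg
  have hi : Integrable (fun x => 1 + b * φ x) ν := (integrable_const _).add (hφi.const_mul _)
  rw [integral_add hi (integrable_const _), integral_add (integrable_const _) (hφi.const_mul _),
    integral_const_mul, integral_const, integral_const, smul_eq_mul, smul_eq_mul] at h
  have h1 : ∫ x, D * b * φ x ∂ν ≤ ∫ x, (1 / 2 * φ x ^ 2 + (D * b) ^ 2 / 2) ∂ν := by
    refine integral_mono (hφi.const_mul _) ((hφ2i.const_mul _).add (integrable_const _))
      fun x => ?_
    dsimp only
    nlinarith [sq_nonneg (φ x - D * b)]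
  rw [integral_const_mul, integral_add (hφ2i.const_mul _) (integrable_const _),
    integral_const_mul, integral_const, smul_eq_mul] at h1
  have h2 : 0 ≤ (D * b) ^ 2 * (k * ν.real univ ^ 2) := by positivity
  nlinarith

lemma StableOutsideBall.integral_sq_le {n : ℕ} {s R D b k : ℝ} {g φ : En n → ℝ}
    (hst : StableOutsideBall n s g R) (hg : Continuous g)
    (hφ : TestOn n (closedBall (0 : En n) R)ᶜ φ) (hφ0 : ∀ x, 0 ≤ φ x)
    {ν : Measure (En n)} [IsFiniteMeasure ν] (hν : ν ≤ expMeasure g)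
    (hD : 0 ≤ D) (hb : 0 ≤ b) (hk : 0 ≤ k)
    (h : ∫⁻ x, ‖fracLap n (s / 2) φ x‖ₑ ^ 2 ≤
      ENNReal.ofReal D * ∫⁻ x, ENNReal.ofReal (1 + b * φ x + k * ν.real univ) ∂ν) :
    Integrable (fun x => φ x ^ 2) ν ∧
      ∫ x, φ x ^ 2 ∂ν ≤ (2 * D + (D * b) ^ 2) * (ν.real univ + k * ν.real univ ^ 2) := by
  have hcs := hφ.2.1.comp_left (g := fun t : ℝ => t ^ 2) (by simp)
  have hφi : Integrable φ ν := hφ.1.continuous.integrable_of_hasCompactSupport hφ.2.1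
  have hφ2i : Integrable (fun x => φ x ^ 2) ν :=
    (hφ.1.continuous.pow 2).integrable_of_hasCompactSupport hcs
  refine ⟨hφ2i, integral_sq_le_of_le_integral hφi hφ2i hk ?_⟩
  have h0 : ∀ y, 0 ≤ 1 + b * φ y + k * ν.real univ := fun y =>
    add_nonneg (add_nonneg zero_le_one (mul_nonneg hb (hφ0 y))) (mul_nonneg hk measureReal_nonneg)
  have hi : Integrable (fun y => 1 + b * φ y + k * ν.real univ) ν :=
    ((integrable_const _).add (hφi.const_mul _)).add (integrable_const _)
  rw [← ENNReal.ofReal_le_ofReal_iff (mul_nonneg hD (integral_nonneg h0)),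
    ENNReal.ofReal_mul hD, ofReal_integral_eq_lintegral_ofReal hi (Eventually.of_forall h0)]
  exact (hst.ofReal_integral_sq_le hg hφ hν).trans h

/-- Testing stability with a truncated Riesz potential of `e^g` on an annulus bounds its `L²`
norm, while the potential itself is controlled by the test function. -/
lemma exists_potential_test {n : ℕ} {s : ℝ} (hs : 1 < s) (hs2 : s < 2) (hn : 2 * s < n) :
    ∃ D : ℝ, 0 ≤ D ∧ ∀ (g : En n → ℝ) (R₀ r₁ r₂ τ : ℝ), Continuous g → 0 < τ → R₀ + τ < r₁ →
      StableOutsideBall n s g R₀ →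
      ∀ ν, ν = (expMeasure g).restrict {x | r₁ ≤ ‖x‖ ∧ ‖x‖ ≤ r₂} →
      ∃ φ : En n → ℝ, Continuous φ ∧ (∀ x, 0 ≤ φ x) ∧ Integrable (fun x => φ x ^ 2) ν ∧
        ∫ x, φ x ^ 2 ∂ν ≤
          D * (ν.real univ + (τ / 2) ^ (-((n : ℝ) - 2 * s)) * ν.real univ ^ 2) ∧
        ∀ x, ∫⁻ z, rieszKer ((n : ℝ) - 2 * s) (x - z) ∂ν ≤
          ENNReal.ofReal (1 + 4 ^ ((n : ℝ) - 2 * s) * φ x +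
            (τ / 2) ^ (-((n : ℝ) - 2 * s)) * ν.real univ) := by
  have hn1 : 1 ≤ n := by
    have : (1 : ℝ) ≤ n := by linarith
    exact_mod_cast this
  obtain ⟨D', hD', hDle⟩ := exists_lintegral_fracLap_truncPot_sq_le hs hs2 hn
  set a : ℝ := (n : ℝ) - 2 * s with ha
  have ha0 : 0 < a := by linarith
  set D₀ := D'.toReal with hD₀
  have hD₀0 : 0 ≤ D₀ := ENNReal.toReal_nonneg
  refine ⟨2 * D₀ + (D₀ * 4 ^ a) ^ 2, by positivity, ?_⟩
  intro g R₀ r₁ r₂ τ hg hτ hR hst ν hν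
  set K : Set (En n) := {x | r₁ ≤ ‖x‖ ∧ ‖x‖ ≤ r₂} with hKd
  have hKc : IsCompact K := by
    refine (isCompact_closedBall (0 : En n) r₂).of_isClosed_subset
      ((isClosed_le continuous_const continuous_norm).inter
        (isClosed_le continuous_norm continuous_const)) fun x hx => ?_
    exact mem_closedBall_zero_iff.2 hx.2
  obtain ⟨G, hG, hGle⟩ := exists_expMeasure_restrict_le hg hKc
  rw [← hν] at hGle
  have : IsFiniteMeasure ν := ⟨by
    rw [hν, Measure.restrict_apply_univ]; exact expMeasure_lt_top hg hKc⟩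
  obtain ⟨N, hN⟩ := exists_lintegral_ball_rieszKer_le hn1 (a := a) (by linarith) hτ hG
  set m := ν.real univ with hm
  have hm0 : 0 ≤ m := measureReal_nonneg
  have hmν : ν univ = ENNReal.ofReal m := by simp [hm, Measure.real]
  set φ := truncPot n a τ N ν with hφ
  have hφ0 : ∀ x, 0 ≤ φ x := truncPot_nonneg n a hτ N ν
  have hsm : ContDiff ℝ (⊤ : ℕ∞) φ := contDiff_truncPot n a hτ N ν
  have hφc : Continuous φ := hsm.continuous
  have hae : ∀ᵐ t ∂ν, r₁ ≤ ‖t‖ ∧ ‖t‖ ≤ r₂ := by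
    rw [hν]; exact ae_restrict_mem hKc.measurableSet
  have hsup := tsupport_truncPot_subset n a hτ N hae
  have hcs : HasCompactSupport φ :=
    (isCompact_closedBall (0 : En n) (r₂ + τ)).of_isClosed_subset (isClosed_tsupport _)
      fun x hx => mem_closedBall_zero_iff.2 (hsup hx).2
  have hP : ∀ x, ∫⁻ z, rieszKer a (x - z) ∂ν ≤
      ENNReal.ofReal (1 + 4 ^ a * φ x + (τ / 2) ^ (-a) * m) := by
    intro x
    have h4 : 0 ≤ 4 ^ a * φ x := mul_nonneg (by positivity) (hφ0 x)
    have hk : 0 ≤ (τ / 2) ^ (-a) := by positivity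
    rw [ENNReal.ofReal_add (add_nonneg one_pos.le h4) (mul_nonneg hk hm0),
      ENNReal.ofReal_add one_pos.le h4, ENNReal.ofReal_one, ENNReal.ofReal_mul hk, ← hmν]
    have h5 := lintegral_rieszKer_le_truncPot ha0 hτ N ν hGle x
    rw [← hφ] at h5
    exact h5.trans (add_le_add (add_le_add hN le_rfl) le_rfl)
  have htest : TestOn n (closedBall (0 : En n) R₀)ᶜ φ := by
    refine ⟨hsm, hcs, fun x hx => ?_⟩
    rw [mem_compl_iff, mem_closedBall_zero_iff, not_le]
    linarith [(hsup hx).1]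
  have hDφ : ∫⁻ x, ‖fracLap n (s / 2) φ x‖ₑ ^ 2 ≤ ENNReal.ofReal D₀ *
      ∫⁻ x, ENNReal.ofReal (1 + 4 ^ a * φ x + (τ / 2) ^ (-a) * m) ∂ν := by
    rw [hD₀, ENNReal.ofReal_toReal hD']
    refine (hDle τ N ν hτ hcs).trans ?_
    gcongr with y
    exact hP y
  obtain ⟨h1, h2⟩ := hst.integral_sq_le hg htest hφ0
    (by rw [hν]; exact Measure.restrict_le_self) hD₀0 (by positivity) (by positivity) hDφ
  exact ⟨φ, hφc, hφ0, h1, h2, hP⟩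

lemma exp_uscale {n : ℕ} (s : ℝ) (u : En n → ℝ) {l : ℝ} (hl : 0 < l) (x : En n) :
    Real.exp (uscale n s u l x) = l ^ (2 * s) * Real.exp (u (l • x)) := by
  rw [uscale, Real.exp_add, mul_comm (Real.exp _), mul_comm (2 * s), Real.exp_mul,
    Real.exp_log hl]

lemma continuous_uscale {n : ℕ} (s : ℝ) {u : En n → ℝ} (hu : Continuous u) (l : ℝ) :
    Continuous (uscale n s u l) := by
  unfold uscale; fun_prop

lemma StableOutsideBall.uscale {n : ℕ} (hn : 1 ≤ n) {s : ℝ} (hs : 0 < s) (hs2 : s < 2)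
    {u : En n → ℝ} {R : ℝ} (hst : StableOutsideBall n s u R) {l : ℝ} (hl : 0 < l) :
    StableOutsideBall n s (uscale n s u l) (R / l) := by
  intro φ hφ
  have hl' : 0 < l⁻¹ := inv_pos.2 hl
  have hC2 : ContDiff ℝ 2 φ := contDiff_infty.1 hφ.1 2
  have hc : Continuous fun x : En n => l⁻¹ • x := continuous_const_smul _
  have htest : TestOn n (closedBall (0 : En n) R)ᶜ fun x => φ (l⁻¹ • x) := by
    refine ⟨hφ.1.comp (contDiff_const_smul _), hφ.2.1.comp_smul hl'.ne', fun x hx => ?_⟩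
    have h1 := hφ.2.2 (tsupport_comp_subset_preimage φ hc hx)
    rw [mem_compl_iff, mem_closedBall_zero_iff, not_le, norm_smul, Real.norm_eq_abs,
      abs_of_pos hl', div_eq_inv_mul] at h1
    rw [mem_compl_iff, mem_closedBall_zero_iff, not_le]
    exact lt_of_mul_lt_mul_left h1 hl'.le
  have h2 := hst _ htest
  simp only [fracLap_comp_smul hn (half_pos hs) (by linarith : s / 2 < 1) hC2 hφ.2.1 hl'] at h2
  have h3 := Measure.integral_comp_inv_smul (volume : Measure (En n))
    (fun x => Real.exp (u (l • x)) * φ x ^ 2) l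
  have h4 := Measure.integral_comp_inv_smul (volume : Measure (En n))
    (fun x => (l⁻¹ ^ (2 * (s / 2)) * fracLap n (s / 2) φ x) ^ 2) l
  simp only [smul_inv_smul₀ hl.ne'] at h3
  rw [h3, h4, smul_eq_mul, smul_eq_mul] at h2
  have h5 := le_of_mul_le_mul_left h2 (abs_pos.2 (by positivity))
  have h6 : (l⁻¹ ^ (2 * (s / 2))) ^ 2 = l ^ (-(2 * s)) := by
    rw [Real.inv_rpow hl.le, ← Real.rpow_neg hl.le, ← Real.rpow_natCast, ← Real.rpow_mul hl.le]
    congr 1; push_cast; ring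
  simp only [mul_pow, h6] at h5
  rw [integral_const_mul] at h5
  simp only [exp_uscale s u hl, mul_assoc]
  rw [integral_const_mul]
  have h7 := mul_le_mul_of_nonneg_left h5 (by positivity : 0 ≤ l ^ (2 * s))
  rwa [← mul_assoc, ← Real.rpow_add hl, add_neg_cancel, Real.rpow_zero, one_mul] at h7

lemma lintegral_expMeasure_uscale {n : ℕ} (s : ℝ) {u : En n → ℝ} (hu : Continuous u) {l : ℝ}
    (hl : 0 < l) {f : En n → ENNReal} (hf : Measurable f) :
    ∫⁻ z, f (l • z) ∂expMeasure (uscale n s u l) =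
      ENNReal.ofReal (l ^ (-((n : ℝ) - 2 * s))) * ∫⁻ z, f z ∂expMeasure u := by
  rw [lintegral_expMeasure (f := fun z => f (l • z)) (continuous_uscale s hu l)
      (hf.comp (measurable_const_smul l)), lintegral_expMeasure hu hf]
  simp only [exp_uscale s u hl, ENNReal.ofReal_mul (Real.rpow_nonneg hl.le _), mul_assoc]
  rw [lintegral_const_mul _ (by fun_prop), lintegral_comp_smul_pos
    (fun z => ENNReal.ofReal (Real.exp (u z)) * f z) hl, ← mul_assoc,
    ← ENNReal.ofReal_mul (by positivity), ← Real.rpow_add hl]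
  congr 3; ring

lemma expMeasure_uscale_apply {n : ℕ} (s : ℝ) {u : En n → ℝ} (hu : Continuous u) {l : ℝ}
    (hl : 0 < l) {S T : Set (En n)} (hS : MeasurableSet S) (hT : MeasurableSet T)
    (hST : ∀ x, x ∈ T ↔ l • x ∈ S) :
    expMeasure (uscale n s u l) T =
      ENNReal.ofReal (l ^ (-((n : ℝ) - 2 * s))) * expMeasure u S := by
  have h := lintegral_expMeasure_uscale s hu hl (f := S.indicator 1) (measurable_one.indicator hS)
  rw [lintegral_indicator_one hS] at h
  rw [← h, ← lintegral_indicator_one hT]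
  refine lintegral_congr fun x => ?_
  by_cases hx : x ∈ T
  · simp [hx, (hST x).1 hx]
  · simp [hx, mt (hST x).2 hx]

/-- A smooth cutoff equal to one on the annulus `1 ≤ ‖x‖ ≤ 2` and supported outside
`closedBall 0 (1/2)`. -/
lemma exists_annulus_cutoff (n : ℕ) : ∃ h : En n → ℝ,
    TestOn n (closedBall (0 : En n) (1 / 2))ᶜ h ∧ ∀ x, 1 ≤ ‖x‖ → ‖x‖ ≤ 2 → h x = 1 := by
  let b₁ : ContDiffBump (0 : En n) := ⟨2, 3, by norm_num, by norm_num⟩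
  let b₂ : ContDiffBump (0 : En n) := ⟨3 / 4, 1, by norm_num, by norm_num⟩
  refine ⟨fun x => b₁ x - b₂ x, ⟨b₁.contDiff.sub b₂.contDiff,
    b₁.hasCompactSupport.sub b₂.hasCompactSupport, fun x hx hx' => ?_⟩, fun x h1 h2 => ?_⟩
  · refine (notMem_tsupport_iff_eventuallyEq.2 ?_) hx
    have h1 : x ∈ ball (0 : En n) (3 / 4) := by
      rw [mem_closedBall_zero_iff] at hx'
      rw [mem_ball_zero_iff]; linarith
    filter_upwards [isOpen_ball.mem_nhds h1] with y hy
    rw [b₁.one_of_mem_closedBall, b₂.one_of_mem_closedBall (ball_subset_closedBall hy)]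
    · simp
    · rw [mem_ball_zero_iff] at hy
      rw [mem_closedBall_zero_iff]
      change ‖y‖ ≤ 2
      linarith
  · dsimp only
    rw [b₁.one_of_mem_closedBall (mem_closedBall_zero_iff.2 h2), b₂.zero_of_le_dist, sub_zero]
    rw [dist_zero_right]; exact h1

lemma exists_expMeasure_annulus_le (n : ℕ) (s : ℝ) : ∃ E : ℝ, 0 ≤ E ∧
    ∀ g : En n → ℝ, Continuous g → ∀ R ≤ 1 / 2, StableOutsideBall n s g R →
      expMeasure g {x | 1 ≤ ‖x‖ ∧ ‖x‖ ≤ 2} ≤ ENNReal.ofReal E := by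
  obtain ⟨h, ht, h1⟩ := exists_annulus_cutoff n
  refine ⟨∫ x, (fracLap n (s / 2) h x) ^ 2, integral_nonneg fun x => sq_nonneg _, ?_⟩
  intro g hg R hR hst
  have hc : Continuous h := ht.1.continuous
  have hcs : HasCompactSupport fun x => h x ^ 2 :=
    ht.2.1.comp_left (g := fun t : ℝ => t ^ 2) (by simp)
  have hi : Integrable fun x => Real.exp (g x) * h x ^ 2 :=
    (Continuous.mul (by fun_prop) (hc.pow 2)).integrable_of_hasCompactSupport hcs.mul_left
  have hm : MeasurableSet {x : En n | 1 ≤ ‖x‖ ∧ ‖x‖ ≤ 2} :=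
    (measurableSet_le measurable_const measurable_norm).inter
      (measurableSet_le measurable_norm measurable_const)
  refine le_trans ?_ (ENNReal.ofReal_le_ofReal (hst h ⟨ht.1, ht.2.1, ht.2.2.trans
    (compl_subset_compl.2 (closedBall_subset_closedBall hR))⟩))
  rw [ofReal_integral_eq_lintegral_ofReal hi (Eventually.of_forall fun x => by
    dsimp only [Pi.zero_apply]; positivity), expMeasure, withDensity_apply _ hm]
  refine (setLIntegral_mono (by fun_prop) fun x hx => ?_).trans (setLIntegral_le_lintegral _ _)
  rw [h1 x hx.1 hx.2, one_pow, mul_one]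

lemma exists_expMeasure_ball_le {n : ℕ} (hn1 : 1 ≤ n) {s : ℝ} (hs : 0 < s) (hs2 : s < 2)
    (hn : 2 * s < n) {u : En n → ℝ} (hu : Continuous u) {R : ℝ} (hR : 0 < R)
    (hst : StableOutsideBall n s u R) : ∃ A : ℝ, 0 ≤ A ∧ ∀ r : ℝ, 0 < r →
      expMeasure u (ball 0 r) ≤ ENNReal.ofReal (A * r ^ ((n : ℝ) - 2 * s)) := by
  obtain ⟨E, hE, hEle⟩ := exists_expMeasure_annulus_le n s
  set a : ℝ := (n : ℝ) - 2 * s with ha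
  have ha0 : 0 < a := by linarith
  have h2a : 1 < (2 : ℝ) ^ a := Real.one_lt_rpow (by norm_num) ha0
  obtain ⟨G, hG, hGle⟩ := exists_expMeasure_restrict_le hu (isCompact_closedBall (0 : En n) (4 * R))
  set V : ℝ := (volume (ball (0 : En n) 1)).toReal with hV
  set A : ℝ := G.toReal * V * (4 * R) ^ (2 * s) + E / (2 ^ a - 1) with hA
  have hA1 : 0 ≤ E / (2 ^ a - 1) := div_nonneg hE (by linarith)
  have hA2 : 0 ≤ G.toReal * V * (4 * R) ^ (2 * s) := by positivity
  have hA0 : 0 ≤ A := add_nonneg hA2 hA1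
  refine ⟨A, hA0, ?_⟩
  have key : ∀ k : ℕ, ∀ r : ℝ, 0 < r → r ≤ 2 ^ k * (4 * R) →
      expMeasure u (ball 0 r) ≤ ENNReal.ofReal (A * r ^ a) := by
    intro k
    induction k with
    | zero =>
      intro r hr hr'
      rw [pow_zero, one_mul] at hr'
      have h1 := hGle (ball 0 r)
      rw [Measure.restrict_apply measurableSet_ball, inter_eq_left.2
        ((ball_subset_ball hr').trans ball_subset_closedBall), Measure.smul_apply, smul_eq_mul,
        Measure.addHaar_ball_of_pos volume _ hr, ← ENNReal.ofReal_toReal hG,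
        ← ENNReal.ofReal_toReal (measure_ball_lt_top (μ := volume) (x := (0 : En n)) (r := 1)).ne,
        ← ENNReal.ofReal_mul (by positivity), ← ENNReal.ofReal_mul (by positivity)] at h1
      refine h1.trans (ENNReal.ofReal_le_ofReal ?_)
      have h2 : r ^ Module.finrank ℝ (En n) = r ^ (2 * s) * r ^ a := by
        rw [← Real.rpow_add hr, ha, ← Real.rpow_natCast]
        congr 1; simp
      have h3 : r ^ (2 * s) ≤ (4 * R) ^ (2 * s) := Real.rpow_le_rpow hr.le hr' (by linarith)
      have h4 : 0 ≤ r ^ a := by positivity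
      rw [h2, ← hV]
      calc G.toReal * (r ^ (2 * s) * r ^ a * V) = G.toReal * V * r ^ (2 * s) * r ^ a := by ring
        _ ≤ G.toReal * V * (4 * R) ^ (2 * s) * r ^ a := by gcongr
        _ ≤ A * r ^ a := by gcongr; linarith
    | succ k ih =>
      intro r hr hr'
      by_cases hsm : r ≤ 4 * R
      · exact ih r hr (hsm.trans (le_mul_of_one_le_left (by positivity)
          (one_le_pow₀ (by norm_num))))
      rw [not_le] at hsm
      have hr2 : 0 < r / 2 := by positivity
      have h1 := ih (r / 2) hr2 (by rw [pow_succ] at hr'; linarith)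
      have hRr : R / (r / 2) ≤ 1 / 2 := by rw [div_le_iff₀ hr2]; linarith
      have h2 := hEle _ (continuous_uscale s hu (r / 2)) _ hRr (hst.uscale hn1 hs hs2 hr2)
      have hm : ∀ α β : ℝ, MeasurableSet {x : En n | α ≤ ‖x‖ ∧ ‖x‖ ≤ β} := fun α β =>
        (measurableSet_le measurable_const measurable_norm).inter
          (measurableSet_le measurable_norm measurable_const)
      rw [expMeasure_uscale_apply s hu hr2 (S := {x : En n | r / 2 ≤ ‖x‖ ∧ ‖x‖ ≤ r})
        (hm _ _) (hm _ _)] at h2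
      · have h3 : expMeasure u {x : En n | r / 2 ≤ ‖x‖ ∧ ‖x‖ ≤ r} ≤
            ENNReal.ofReal (E * (r / 2) ^ a) := by
          have h4 := mul_le_mul_right h2 (ENNReal.ofReal ((r / 2) ^ a))
          rwa [← mul_assoc, ← ENNReal.ofReal_mul (by positivity), ← Real.rpow_add hr2, ← ha,
            add_neg_cancel, Real.rpow_zero, ENNReal.ofReal_one, one_mul,
            ← ENNReal.ofReal_mul (by positivity), mul_comm ((r / 2) ^ a)] at h4
        calc expMeasure u (ball 0 r)
            ≤ expMeasure u (ball 0 (r / 2) ∪ {x : En n | r / 2 ≤ ‖x‖ ∧ ‖x‖ ≤ r}) := by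
              refine measure_mono fun x hx => ?_
              rw [mem_ball_zero_iff] at hx
              rcases lt_or_ge ‖x‖ (r / 2) with h | h
              · exact Or.inl (mem_ball_zero_iff.2 h)
              · exact Or.inr ⟨h, hx.le⟩
          _ ≤ _ := measure_union_le _ _
          _ ≤ _ := add_le_add h1 h3
          _ = ENNReal.ofReal (A * (r / 2) ^ a + E * (r / 2) ^ a) :=
              (ENNReal.ofReal_add (by positivity) (by positivity)).symm
          _ ≤ ENNReal.ofReal (A * r ^ a) := by
              refine ENNReal.ofReal_le_ofReal ?_
              have h5 : r ^ a = 2 ^ a * (r / 2) ^ a := by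
                rw [← Real.mul_rpow (by norm_num) hr2.le]; congr 1; ring
              have h6 : E ≤ A * (2 ^ a - 1) := by
                rw [← div_le_iff₀ (by linarith)]; linarith
              rw [h5]
              nlinarith [(by positivity : 0 ≤ (r / 2) ^ a)]
      · intro x
        simp only [mem_ofPred_eq, norm_smul, Real.norm_eq_abs, abs_of_pos hr2]
        constructor
        · rintro ⟨h, h'⟩; constructor <;> nlinarith
        · rintro ⟨h, h'⟩; constructor <;> nlinarith
  intro r hr
  obtain ⟨k, hk⟩ := pow_unbounded_of_one_lt (r / (4 * R)) (one_lt_two (α := ℝ))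
  exact key k r hr (by rw [div_lt_iff₀ (by positivity)] at hk; exact hk.le)

lemma expMeasure_uscale_ball_le {n : ℕ} {s : ℝ} {u : En n → ℝ} (hu : Continuous u) {A : ℝ}
    (hA : ∀ r : ℝ, 0 < r →
      expMeasure u (ball 0 r) ≤ ENNReal.ofReal (A * r ^ ((n : ℝ) - 2 * s)))
    {l : ℝ} (hl : 0 < l) {r : ℝ} (hr : 0 < r) :
    expMeasure (uscale n s u l) (ball 0 r) ≤ ENNReal.ofReal (A * r ^ ((n : ℝ) - 2 * s)) := by
  rw [expMeasure_uscale_apply s hu hl (S := ball 0 (l * r)) measurableSet_ball measurableSet_ball]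
  · refine (mul_le_mul_right (hA (l * r) (by positivity)) _).trans ?_
    rw [← ENNReal.ofReal_mul (by positivity), Real.mul_rpow hl.le hr.le, Real.rpow_neg hl.le]
    refine ENNReal.ofReal_le_ofReal (le_of_eq ?_)
    field_simp
  · intro x
    simp only [mem_ball_zero_iff, norm_smul, Real.norm_eq_abs, abs_of_pos hl]
    exact (mul_lt_mul_iff_right₀ hl).symm

lemma setLIntegral_compl_ball_rpow_le {n : ℕ} {μ : Measure (En n)} {A a : ℝ} (hA0 : 0 ≤ A)
    (ha : 0 ≤ a) (hA : ∀ r : ℝ, 0 < r → μ (ball 0 r) ≤ ENNReal.ofReal (A * r ^ a)) {r : ℝ}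
    (hr : 0 < r) :
    ∫⁻ z in (ball 0 r)ᶜ, ENNReal.ofReal (‖z‖ ^ (-(a + 1))) ∂μ ≤
      ENNReal.ofReal (2 * 2 ^ a * A / r) := by
  let S : ℕ → Set (En n) := fun k => {z | 2 ^ k * r ≤ ‖z‖ ∧ ‖z‖ < 2 * 2 ^ k * r}
  have hS : ((ball 0 r)ᶜ : Set (En n)) ⊆ ⋃ k, S k := by
    intro z hz
    rw [mem_compl_iff, mem_ball_zero_iff, not_lt] at hz
    obtain ⟨k, hk, hk'⟩ := exists_nat_pow_near (x := ‖z‖ / r) (y := 2)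
      ((one_le_div hr).2 hz) one_lt_two
    rw [le_div_iff₀ hr] at hk
    rw [div_lt_iff₀ hr, pow_succ, mul_comm _ (2 : ℝ)] at hk'
    exact mem_iUnion.2 ⟨k, hk, hk'⟩
  have hk : ∀ k, ∫⁻ z in S k, ENNReal.ofReal (‖z‖ ^ (-(a + 1))) ∂μ ≤
      ENNReal.ofReal (2 ^ a * A / r * (1 / 2) ^ k) := by
    intro k
    have hp : 0 < 2 ^ k * r := by positivity
    calc ∫⁻ z in S k, ENNReal.ofReal (‖z‖ ^ (-(a + 1))) ∂μ
        ≤ ∫⁻ z in S k, ENNReal.ofReal ((2 ^ k * r) ^ (-(a + 1))) ∂μ := by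
          refine setLIntegral_mono measurable_const fun z hz => ENNReal.ofReal_le_ofReal ?_
          exact Real.rpow_le_rpow_of_nonpos hp hz.1 (by linarith)
      _ = ENNReal.ofReal ((2 ^ k * r) ^ (-(a + 1))) * μ (S k) := setLIntegral_const _ _
      _ ≤ ENNReal.ofReal ((2 ^ k * r) ^ (-(a + 1))) *
            ENNReal.ofReal (A * (2 * 2 ^ k * r) ^ a) := by
          gcongr
          exact (measure_mono fun z hz => mem_ball_zero_iff.2 hz.2).trans (hA _ (by positivity))
      _ = ENNReal.ofReal (2 ^ a * A / r * (1 / 2) ^ k) := by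
          rw [← ENNReal.ofReal_mul (by positivity)]
          congr 1
          rw [mul_assoc 2, Real.mul_rpow (by norm_num) hp.le, neg_add, Real.rpow_add hp,
            Real.rpow_neg hp.le, Real.rpow_neg_one, one_div, inv_pow]
          have : (2 ^ k * r) ^ a ≠ 0 := by positivity
          field_simp
  calc _ ≤ ∫⁻ z in ⋃ k, S k, ENNReal.ofReal (‖z‖ ^ (-(a + 1))) ∂μ := lintegral_mono_set hS
    _ ≤ ∑' k, ∫⁻ z in S k, ENNReal.ofReal (‖z‖ ^ (-(a + 1))) ∂μ := lintegral_iUnion_le _ _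
    _ ≤ ∑' k : ℕ, ENNReal.ofReal (2 ^ a * A / r * (1 / 2) ^ k) := ENNReal.tsum_le_tsum hk
    _ = ENNReal.ofReal (∑' k : ℕ, 2 ^ a * A / r * (1 / 2) ^ k) :=
        (ENNReal.ofReal_tsum_of_nonneg (fun k => by positivity)
          (summable_geometric_two.mul_left _)).symm
    _ = _ := by rw [tsum_mul_left, tsum_geometric_two]; congr 1; ring

/-- The integral of `(1 + ‖z‖)^{-(a+1)}` against a measure, which governs how the normalizing
constant of the potential of that measure changes under scaling. -/
def decayInt {n : ℕ} (a : ℝ) (μ : Measure (En n)) : ENNReal :=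
  ∫⁻ z, ENNReal.ofReal ((1 + ‖z‖) ^ (-(a + 1))) ∂μ

lemma decayInt_le_of_annulus_le {n : ℕ} {μ : Measure (En n)} {A a : ℝ} (hA0 : 0 ≤ A)
    (ha : 0 ≤ a) (hA : ∀ r : ℝ, 0 < r → μ (ball 0 r) ≤ ENNReal.ofReal (A * r ^ a)) {r R M : ℝ}
    (hr : 0 < r) (hR : 0 < R) (hM : 0 ≤ M) (h : μ {x | r ≤ ‖x‖ ∧ ‖x‖ ≤ R} ≤ ENNReal.ofReal M) :
    decayInt a μ ≤ ENNReal.ofReal (A * r ^ a + M + 2 * 2 ^ a * A / R) := by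
  set f : En n → ENNReal := fun z => ENNReal.ofReal ((1 + ‖z‖) ^ (-(a + 1))) with hf
  have hf1 : ∀ z, f z ≤ 1 := fun z => by
    rw [hf, ENNReal.ofReal_le_one]
    exact Real.rpow_le_one_of_one_le_of_nonpos (by linarith [norm_nonneg z]) (by linarith)
  have hsub : (univ : Set (En n)) ⊆ (ball 0 r ∪ {x | r ≤ ‖x‖ ∧ ‖x‖ ≤ R}) ∪ (ball 0 R)ᶜ := by
    intro x _
    rcases lt_or_ge ‖x‖ r with h1 | h1
    · exact Or.inl (Or.inl (mem_ball_zero_iff.2 h1))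
    rcases lt_or_ge R ‖x‖ with h2 | h2
    · exact Or.inr (by rw [mem_compl_iff, mem_ball_zero_iff]; linarith)
    · exact Or.inl (Or.inr ⟨h1, h2⟩)
  have hset : ∀ S : Set (En n), ∫⁻ z in S, f z ∂μ ≤ μ S := fun S => by
    simpa using lintegral_mono (μ := μ.restrict S) hf1
  rw [ENNReal.ofReal_add (by positivity) (by positivity),
    ENNReal.ofReal_add (by positivity) (by positivity), decayInt, ← setLIntegral_univ]
  refine (lintegral_mono_set hsub).trans ((lintegral_union_le _ _ _).trans
    (add_le_add ((lintegral_union_le _ _ _).trans (add_le_add ((hset _).trans (hA r hr))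
      ((hset _).trans h))) ?_))
  refine le_trans ?_ (setLIntegral_compl_ball_rpow_le hA0 ha hA hR)
  refine setLIntegral_mono (by fun_prop) fun z hz => ENNReal.ofReal_le_ofReal ?_
  rw [mem_compl_iff, mem_ball_zero_iff, not_lt] at hz
  exact Real.rpow_le_rpow_of_nonpos (hR.trans_le hz) (by linarith) (by linarith)

lemma decayInt_le {n : ℕ} {μ : Measure (En n)} {A a : ℝ} (hA0 : 0 ≤ A)
    (ha : 0 ≤ a) (hA : ∀ r : ℝ, 0 < r → μ (ball 0 r) ≤ ENNReal.ofReal (A * r ^ a)) :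
    decayInt a μ ≤ ENNReal.ofReal (A * (1 + 2 ^ a + 2 * 2 ^ a)) := by
  have h := decayInt_le_of_annulus_le hA0 ha hA one_pos one_pos (M := A * 2 ^ a) (by positivity)
    ((measure_mono fun x hx => mem_ball_zero_iff.2 (hx.2.trans_lt one_lt_two)).trans
      (hA 2 two_pos))
  refine h.trans_eq ?_
  rw [Real.one_rpow]; congr 1; ring

lemma cRiesz_nonneg {n : ℕ} {s : ℝ} (hs : 0 < s) (hn : 2 * s < n) : 0 ≤ cRiesz n s := by
  have h1 := Real.Gamma_pos_of_pos hs
  have h2 := Real.Gamma_pos_of_pos (s := (n : ℝ) / 2 - s) (by linarith)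
  unfold cRiesz; positivity

lemma rpow_neg_sub_rpow_neg_le {a d e : ℝ} (ha : 0 ≤ a) (hd : 0 < d) (hde : d ≤ e) :
    d ^ (-a) - e ^ (-a) ≤ a * (e - d) * d ^ (-(a + 1)) := by
  have he : 0 < e := hd.trans_le hde
  have hx : 0 < e / d := by positivity
  have h1 : 1 - a * (e / d - 1) ≤ (e / d) ^ (-a) := by
    rw [Real.rpow_def_of_pos hx]
    have h2 := Real.add_one_le_exp (Real.log (e / d) * -a)
    have h3 := Real.log_le_sub_one_of_pos hx
    nlinarith
  have h4 : e ^ (-a) = d ^ (-a) * (e / d) ^ (-a) := by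
    rw [← Real.mul_rpow hd.le hx.le]; congr 1; field_simp
  have h5 : d ^ (-(a + 1)) = d ^ (-a) / d := by
    rw [neg_add, Real.rpow_add hd, Real.rpow_neg_one]; rfl
  have h6 := mul_le_mul_of_nonneg_left h1 (Real.rpow_nonneg hd.le (-a))
  rw [h4, h5]
  calc d ^ (-a) - d ^ (-a) * (e / d) ^ (-a) ≤ d ^ (-a) - d ^ (-a) * (1 - a * (e / d - 1)) := by
        linarith
    _ = a * (e - d) * (d ^ (-a) / d) := by field_simp; ring

lemma rpow_neg_sub_rpow_neg_le_of_le_add {a b d e τ : ℝ} (ha : 0 ≤ a) (hτ : 0 < τ) (hb : 0 ≤ b)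
    (hd : τ ≤ d) (he : 0 < e) (hde : e ≤ d + b) :
    d ^ (-a) - e ^ (-a) ≤ a * b * (1 + b / τ) ^ (a + 1) * e ^ (-(a + 1)) := by
  have hd0 : 0 < d := hτ.trans_le hd
  have h0 : 0 < 1 + b / τ := by positivity
  rcases le_total e d with h | h
  · have h1 := Real.rpow_le_rpow_of_nonpos he h (by linarith : -a ≤ 0)
    have h2 : 0 ≤ a * b * (1 + b / τ) ^ (a + 1) * e ^ (-(a + 1)) := by positivity
    linarith
  · refine (rpow_neg_sub_rpow_neg_le ha hd0 h).trans ?_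
    have h1 : e ≤ (1 + b / τ) * d := by
      have : b ≤ b / τ * d := by
        rw [div_mul_eq_mul_div, le_div_iff₀ hτ]; exact mul_le_mul_of_nonneg_left hd hb
      linarith
    have h2 := Real.rpow_le_rpow_of_nonpos he h1 (by linarith : -(a + 1) ≤ 0)
    rw [Real.mul_rpow h0.le hd0.le, Real.rpow_neg h0.le] at h2
    have h3 : d ^ (-(a + 1)) ≤ (1 + b / τ) ^ (a + 1) * e ^ (-(a + 1)) := by
      rwa [inv_mul_le_iff₀ (by positivity)] at h2
    calc a * (e - d) * d ^ (-(a + 1)) ≤ a * b * ((1 + b / τ) ^ (a + 1) * e ^ (-(a + 1))) := by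
          gcongr; linarith
      _ = _ := by ring

lemma exp_le_of_eq_wpot_add {n : ℕ} (hn1 : 1 ≤ n) {s : ℝ} (hs : 0 < s) (hn : 2 * s < n)
    {g : En n → ℝ} (hg : Continuous g) {c : ℝ} (h : ∀ x, g x = wpot n s g x + c) {A : ℝ}
    (hA0 : 0 ≤ A) (hA : expMeasure g (ball 0 1) ≤ ENNReal.ofReal A) :
    Real.exp c * volume.real (ball (0 : En n) 1) ≤ A := by
  have : Nonempty (Fin n) := ⟨⟨0, hn1⟩⟩
  have : Nontrivial (En n) := inferInstance
  have hc : ∀ x ∈ ball (0 : En n) 1, c ≤ g x := by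
    intro x hx
    rw [h x, wpot]
    refine le_add_of_nonneg_left (mul_nonneg (cRiesz_nonneg hs hn) (integral_nonneg_of_ae ?_))
    filter_upwards [compl_mem_ae_iff.2 (measure_singleton x)] with z hz
    have h1 : 0 < ‖x - z‖ := norm_pos_iff.2 (sub_ne_zero.2 fun h => hz h.symm)
    refine mul_nonneg (sub_nonneg.2 (one_div_le_one_div_of_le (by positivity)
      (Real.rpow_le_rpow h1.le ?_ (by linarith)))) (Real.exp_nonneg _)
    rw [mem_ball_zero_iff] at hx
    linarith [norm_sub_le x z]
  rw [← ENNReal.ofReal_le_ofReal_iff hA0, ENNReal.ofReal_mul (Real.exp_nonneg _),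
    ofReal_measureReal (measure_ball_lt_top).ne, ← setLIntegral_const]
  refine le_trans ?_ hA
  rw [expMeasure, withDensity_apply _ measurableSet_ball]
  exact setLIntegral_mono (by fun_prop) fun x hx =>
    ENNReal.ofReal_le_ofReal (Real.exp_le_exp.2 (hc x hx))

lemma decayInt_expMeasure {n : ℕ} (a : ℝ) {g : En n → ℝ} (hg : Continuous g) :
    decayInt a (expMeasure g) =
      ∫⁻ z, ENNReal.ofReal ((1 + ‖z‖) ^ (-(a + 1)) * Real.exp (g z)) := by
  rw [decayInt, lintegral_expMeasure hg (by fun_prop)]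
  refine lintegral_congr fun z => ?_
  rw [mul_comm, ENNReal.ofReal_mul (by positivity)]

lemma integrable_decay {n : ℕ} {a : ℝ} {g : En n → ℝ} (hg : Continuous g)
    (h : decayInt a (expMeasure g) ≠ ⊤) :
    Integrable fun z : En n => (1 + ‖z‖) ^ (-(a + 1)) * Real.exp (g z) := by
  rw [decayInt_expMeasure a hg] at h
  exact (lintegral_ofReal_ne_top_iff_integrable
    (Measurable.aestronglyMeasurable (by fun_prop))
    (Eventually.of_forall fun z => by dsimp only [Pi.zero_apply]; positivity)).1 h

lemma integral_decay_le {n : ℕ} {a : ℝ} {g : En n → ℝ} (hg : Continuous g) {B : ℝ} (hB : 0 ≤ B)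
    (h : decayInt a (expMeasure g) ≤ ENNReal.ofReal B) :
    ∫ z : En n, (1 + ‖z‖) ^ (-(a + 1)) * Real.exp (g z) ≤ B := by
  have hi := integrable_decay hg (h.trans_lt ENNReal.ofReal_lt_top).ne
  rwa [decayInt_expMeasure a hg, ← ofReal_integral_eq_lintegral_ofReal hi
    (Eventually.of_forall fun z => by dsimp only [Pi.zero_apply]; positivity),
    ENNReal.ofReal_le_ofReal_iff hB] at h

lemma integrable_wpot_zero {n : ℕ} (hn1 : 1 ≤ n) {a : ℝ} (ha : 0 ≤ a) (han : a < n)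
    {g : En n → ℝ} (hg : Continuous g) (h : decayInt a (expMeasure g) ≠ ⊤) :
    Integrable fun z : En n => (1 / ‖z‖ ^ a - 1 / (1 + ‖z‖) ^ a) * Real.exp (g z) := by
  have : Nonempty (Fin n) := ⟨⟨0, hn1⟩⟩
  have : Nontrivial (En n) := inferInstance
  obtain ⟨M, hM⟩ :=
    ((isCompact_closedBall (0 : En n) 1).image (Real.continuous_exp.comp hg)).bddAbove
  have hM' : ∀ z ∈ closedBall (0 : En n) 1, Real.exp (g z) ≤ M := fun z hz =>
    hM (mem_image_of_mem _ hz)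
  have hi1 : Integrable ((ball (0 : En n) 1).indicator fun x => ‖x‖ ^ (-a)) :=
    (integrable_indicator_iff measurableSet_ball).2 (integrableOn_ball_rpow hn1 han 1)
  have hi2 := (integrable_decay hg h).const_mul (a * 1 * (1 + 1 / 1) ^ (a + 1))
  refine ((hi1.const_mul M).add hi2).mono' (Measurable.aestronglyMeasurable (by fun_prop)) ?_
  filter_upwards [compl_mem_ae_iff.2 (measure_singleton (0 : En n))] with z hz
  have hz0 : 0 < ‖z‖ := norm_pos_iff.2 hz
  have h1 : 0 ≤ 1 / ‖z‖ ^ a - 1 / (1 + ‖z‖) ^ a :=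
    sub_nonneg.2 (one_div_le_one_div_of_le (by positivity)
      (Real.rpow_le_rpow hz0.le (by linarith) ha))
  have h2 : 0 ≤ a * 1 * (1 + 1 / 1) ^ (a + 1) * ((1 + ‖z‖) ^ (-(a + 1)) * Real.exp (g z)) := by
    positivity
  rw [Real.norm_of_nonneg (mul_nonneg h1 (Real.exp_nonneg _)), Pi.add_apply]
  rw [one_div, one_div, ← Real.rpow_neg hz0.le, ← Real.rpow_neg (by positivity)] at h1 ⊢
  rcases lt_or_ge ‖z‖ 1 with hz1 | hz1
  · rw [indicator_of_mem (mem_ball_zero_iff.2 hz1)]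
    have h3 := hM' z (mem_closedBall_zero_iff.2 hz1.le)
    have h4 : ‖z‖ ^ (-a) - (1 + ‖z‖) ^ (-a) ≤ ‖z‖ ^ (-a) := sub_le_self _ (by positivity)
    have h5 : (‖z‖ ^ (-a) - (1 + ‖z‖) ^ (-a)) * Real.exp (g z) ≤ ‖z‖ ^ (-a) * M :=
      mul_le_mul h4 h3 (Real.exp_nonneg _) (by positivity)
    linarith
  · rw [indicator_of_notMem (by rw [mem_ball_zero_iff]; linarith), mul_zero, zero_add, ← mul_assoc]
    exact mul_le_mul_of_nonneg_right (rpow_neg_sub_rpow_neg_le_of_le_add ha one_pos zero_le_one hz1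
      (by positivity) (by linarith)) (Real.exp_nonneg _)

lemma add_log_sub_le_const_uscale {n : ℕ} (hn1 : 1 ≤ n) {s : ℝ} (hs : 0 < s) (hn : 2 * s < n)
    {g : En n → ℝ} (hg : Continuous g) {t B c c' : ℝ} (ht : 1 ≤ t) (hB : 0 ≤ B)
    (hd : decayInt ((n : ℝ) - 2 * s) (expMeasure g) ≤ ENNReal.ofReal B)
    (hd' : decayInt ((n : ℝ) - 2 * s) (expMeasure (uscale n s g t)) ≠ ⊤)
    (h : g 0 = wpot n s g 0 + c) (h' : uscale n s g t 0 = wpot n s (uscale n s g t) 0 + c') :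
    c + 2 * s * Real.log t - cRiesz n s * (((n : ℝ) - 2 * s) * (t - 1) * B) ≤ c' := by
  have hκ := cRiesz_nonneg hs hn
  rw [wpot] at h h'
  simp only [zero_sub, norm_neg] at h h'
  have ht0 : 0 < t := by linarith
  set a : ℝ := (n : ℝ) - 2 * s with ha
  have ha0 : 0 < a := by linarith
  have hi := integrable_wpot_zero hn1 ha0.le (by linarith) hg
    (hd.trans_lt ENNReal.ofReal_lt_top).ne
  have hi' := integrable_wpot_zero hn1 ha0.le (by linarith) (continuous_uscale s hg t) hd'
  set H : En n → ℝ := fun z => (1 / ‖z‖ ^ a - 1 / (t + ‖z‖) ^ a) * Real.exp (g z) with hH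
  have hscale : (fun z => (1 / ‖z‖ ^ a - 1 / (1 + ‖z‖) ^ a) * Real.exp (uscale n s g t z)) =
      fun z => t ^ n * H (t • z) := by
    ext z
    have h1 : ‖t • z‖ = t * ‖z‖ := by rw [norm_smul, Real.norm_eq_abs, abs_of_pos ht0]
    have h2 : (t : ℝ) ^ n = t ^ (2 * s) * t ^ a := by
      rw [← Real.rpow_add ht0, ← Real.rpow_natCast]; congr 1; rw [ha]; ring
    rw [exp_uscale s g ht0, hH]
    dsimp only
    rw [h1, show t + t * ‖z‖ = t * (1 + ‖z‖) by ring, Real.mul_rpow ht0.le (norm_nonneg _),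
      Real.mul_rpow ht0.le (by positivity), h2, ← one_div_mul_one_div, ← one_div_mul_one_div,
      ← mul_sub]
    have : t ^ a ≠ 0 := by positivity
    field_simp
  rw [hscale] at hi' h'
  rw [integral_const_mul, Measure.integral_comp_smul, smul_eq_mul, ← mul_assoc (t ^ n)] at h'
  have h3 : t ^ n * |(t ^ Module.finrank ℝ (En n))⁻¹| = 1 := by
    rw [abs_of_pos (by positivity), finrank_euclideanSpace_fin, mul_inv_cancel₀ (by positivity)]
  rw [h3, one_mul, uscale, smul_zero] at h'
  have hHi : Integrable H := by
    have h4 : Integrable fun z => H (t • z) := by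
      simpa [← mul_assoc, inv_mul_cancel₀ (pow_ne_zero n ht0.ne')] using hi'.const_mul ((t ^ n)⁻¹)
    exact (integrable_comp_smul_iff volume H ht0.ne').1 h4
  have hdec := integrable_decay hg (hd.trans_lt ENNReal.ofReal_lt_top).ne
  have h5 : ∫ z, H z ≤ ∫ z, ((1 / ‖z‖ ^ a - 1 / (1 + ‖z‖) ^ a) * Real.exp (g z) +
      a * (t - 1) * ((1 + ‖z‖) ^ (-(a + 1)) * Real.exp (g z))) := by
    refine integral_mono hHi (hi.add (hdec.const_mul _)) fun z => ?_
    have h6 := rpow_neg_sub_rpow_neg_le ha0.le (by positivity : 0 < 1 + ‖z‖)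
      (by linarith : 1 + ‖z‖ ≤ t + ‖z‖)
    rw [Real.rpow_neg (by positivity), Real.rpow_neg (by positivity), ← one_div, ← one_div,
      add_sub_add_right_eq_sub] at h6
    have h7 := mul_le_mul_of_nonneg_right h6 (Real.exp_nonneg (g z))
    dsimp only [hH]
    linarith
  rw [integral_add hi (hdec.const_mul _), integral_const_mul] at h5
  have h8 := mul_le_mul_of_nonneg_left (integral_decay_le hg hB hd)
    (mul_nonneg ha0.le (by linarith : 0 ≤ t - 1))
  have h9 := mul_le_mul_of_nonneg_left (h5.trans (add_le_add le_rfl h8)) hκ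
  rw [mul_add] at h9
  linarith

lemma integral_le_of_lintegral_ofReal_le {α : Type*} [MeasurableSpace α] {μ : Measure α}
    {f : α → ℝ} {B : ℝ} (hB : 0 ≤ B) (h : ∫⁻ x, ENNReal.ofReal (f x) ∂μ ≤ ENNReal.ofReal B) :
    ∫ x, f x ∂μ ≤ B := by
  by_cases hf : Integrable f μ
  · rw [integral_eq_lintegral_pos_part_sub_lintegral_neg_part hf]
    have := ENNReal.toReal_mono ENNReal.ofReal_ne_top h
    rw [ENNReal.toReal_ofReal hB] at this
    exact (sub_le_self _ ENNReal.toReal_nonneg).trans this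
  · rwa [integral_undef hf]

lemma wpot_le {n : ℕ} {s : ℝ} (hs : 0 < s) (hn : 2 * s < n) {g : En n → ℝ} (hg : Continuous g)
    {S : Set (En n)} (hS : MeasurableSet S) {x : En n} {τ ρ P J : ℝ} (hτ : 0 < τ)
    (hx : ‖x‖ ≤ ρ) (hxS : ∀ z, z ∉ S → τ ≤ ‖x - z‖) (hP : 0 ≤ P) (hJ : 0 ≤ J)
    (hPle : ∫⁻ z, rieszKer ((n : ℝ) - 2 * s) (x - z) ∂(expMeasure g).restrict S ≤
      ENNReal.ofReal P)
    (hJle : decayInt ((n : ℝ) - 2 * s) (expMeasure g) ≤ ENNReal.ofReal J) :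
    wpot n s g x ≤ cRiesz n s * (P + ((n : ℝ) - 2 * s) * (1 + ρ) *
      (1 + (1 + ρ) / τ) ^ ((n : ℝ) - 2 * s + 1) * J) := by
  set a : ℝ := (n : ℝ) - 2 * s with ha
  have ha0 : 0 < a := by linarith
  have hρ : 0 ≤ ρ := (norm_nonneg x).trans hx
  set C : ℝ := a * (1 + ρ) * (1 + (1 + ρ) / τ) ^ (a + 1) with hC
  have hC0 : 0 ≤ C := by positivity
  rw [wpot]
  refine mul_le_mul_of_nonneg_left (integral_le_of_lintegral_ofReal_le (by positivity) ?_)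
    (cRiesz_nonneg hs hn)
  have hker : ∀ z, ENNReal.ofReal (1 / ‖x - z‖ ^ a - 1 / (1 + ‖z‖) ^ a) ≤
      S.indicator (fun z => rieszKer a (x - z)) z +
        ENNReal.ofReal C * ENNReal.ofReal ((1 + ‖z‖) ^ (-(a + 1))) := by
    intro z
    by_cases hz : z ∈ S
    · rw [indicator_of_mem hz]
      refine le_add_right ?_
      by_cases hxz : x - z = 0
      · rw [hxz, norm_zero, Real.zero_rpow ha0.ne', div_zero, zero_sub, ENNReal.ofReal_of_nonpos]
        · exact zero_le
        · rw [neg_nonpos]; positivity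
      · rw [rieszKer_of_ne a hxz, Real.rpow_neg (norm_nonneg _), ← one_div]
        exact ENNReal.ofReal_le_ofReal (sub_le_self _ (by positivity))
    · rw [indicator_of_notMem hz, zero_add, ← ENNReal.ofReal_mul hC0]
      refine ENNReal.ofReal_le_ofReal ?_
      rw [one_div, one_div, ← Real.rpow_neg (norm_nonneg _), ← Real.rpow_neg (by positivity)]
      refine rpow_neg_sub_rpow_neg_le_of_le_add ha0.le hτ (by positivity) (hxS z hz)
        (by positivity) ?_
      have := norm_sub_le x (x - z)
      rw [sub_sub_cancel] at this
      linarith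
  have hm1 : Measurable (S.indicator fun z => rieszKer a (x - z)) :=
    ((measurable_rieszKer a).comp (measurable_const.sub measurable_id)).indicator hS
  calc ∫⁻ z, ENNReal.ofReal ((1 / ‖x - z‖ ^ a - 1 / (1 + ‖z‖) ^ a) * Real.exp (g z))
      = ∫⁻ z, ENNReal.ofReal (1 / ‖x - z‖ ^ a - 1 / (1 + ‖z‖) ^ a) ∂expMeasure g := by
        rw [lintegral_expMeasure hg (by fun_prop)]
        refine lintegral_congr fun z => ?_
        rw [mul_comm, ENNReal.ofReal_mul (Real.exp_nonneg _)]
    _ ≤ ∫⁻ z, (S.indicator (fun z => rieszKer a (x - z)) z +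
          ENNReal.ofReal C * ENNReal.ofReal ((1 + ‖z‖) ^ (-(a + 1)))) ∂expMeasure g :=
        lintegral_mono hker
    _ = ∫⁻ z, rieszKer a (x - z) ∂(expMeasure g).restrict S +
          ENNReal.ofReal C * decayInt a (expMeasure g) := by
        rw [lintegral_add_left hm1, lintegral_indicator hS, lintegral_const_mul _ (by fun_prop),
          decayInt]
    _ ≤ ENNReal.ofReal P + ENNReal.ofReal C * ENNReal.ofReal J := by gcongr
    _ = ENNReal.ofReal (P + C * J) := by
        rw [← ENNReal.ofReal_mul hC0, ENNReal.ofReal_add hP (by positivity)]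

/-- If the additive constant in the representation of `g` is very negative, then `e^g` has small
mass on a fixed annulus. -/
lemma exists_expMeasure_annulus_le_of_const_le {n : ℕ} {s : ℝ} (hs : 1 < s) (hs2 : s < 2)
    (hn : 2 * s < n) {A δ ε : ℝ} (hA0 : 0 ≤ A) (hδ : 0 < δ) (hε : 0 < ε) :
    ∃ K₀ : ℝ, 0 ≤ K₀ ∧ ∀ (g : En n → ℝ) (c R : ℝ), Continuous g → R ≤ δ / 2 →
      StableOutsideBall n s g R →
      (∀ r : ℝ, 0 < r → expMeasure g (ball 0 r) ≤ ENNReal.ofReal (A * r ^ ((n : ℝ) - 2 * s))) →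
      (∀ x, g x = wpot n s g x + c) → c ≤ -K₀ →
      expMeasure g {x | δ ≤ ‖x‖ ∧ ‖x‖ ≤ 1 / δ} ≤ ENNReal.ofReal ε := by
  obtain ⟨D, hD, hDle⟩ := exists_potential_test hs hs2 hn
  have hs0 : 0 < s := by linarith
  have hκ := cRiesz_nonneg hs0 hn
  set κ := cRiesz n s with hκd
  set a : ℝ := (n : ℝ) - 2 * s with ha
  have ha0 : 0 < a := by linarith
  set τ : ℝ := δ / 8 with hτd
  have hτ : 0 < τ := by positivity
  set ρ : ℝ := 1 / δ with hρ
  have hρ0 : 0 < ρ := by positivity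
  set m : ℝ := A * (ρ + 2) ^ a with hm
  have hm0 : 0 ≤ m := by positivity
  set k : ℝ := (τ / 2) ^ (-a) with hk
  have hk0 : 0 ≤ k := by positivity
  set X : ℝ := D * (m + k * m ^ 2) with hX
  have hX0 : 0 ≤ X := by positivity
  set J : ℝ := A * (1 + 2 ^ a + 2 * 2 ^ a) with hJ
  have hJ0 : 0 ≤ J := by positivity
  set C : ℝ := κ * (1 + k * m + a * (1 + ρ) * (1 + (1 + ρ) / τ) ^ (a + 1) * J) with hC
  have hC0 : 0 ≤ C := by positivity
  set V : ℝ := volume.real (closedBall (0 : En n) ρ) with hV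
  have hlim : Tendsto (fun K : ℝ => Real.exp (-(K / 2)) * V +
      (κ * 4 ^ a / (K / 2 - C)) ^ 2 * X) atTop (nhds (0 * V + 0 ^ 2 * X)) := by
    have h1 : Tendsto (fun K : ℝ => K / 2) atTop atTop := tendsto_id.atTop_div_const two_pos
    have h2 : Tendsto (fun K : ℝ => K / 2 - C) atTop atTop := tendsto_atTop_add_const_right _ _ h1
    exact ((Real.tendsto_exp_neg_atTop_nhds_zero.comp h1).mul_const V).add
      (((h2.const_div_atTop (κ * 4 ^ a)).pow 2).mul_const X)
  rw [zero_mul, zero_pow two_ne_zero, zero_mul, add_zero] at hlim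
  obtain ⟨K₀, hK1, hK2, hK3⟩ := ((hlim.eventually (eventually_le_nhds hε)).and
    ((eventually_gt_atTop (2 * C)).and (eventually_ge_atTop 0))).exists
  refine ⟨K₀, hK3, ?_⟩
  intro g c R hg hR hst hA hrep hc
  set T : ℝ := K₀ / 2 - C with hT
  have hT0 : 0 < T := by linarith
  set S : Set (En n) := {x | 7 * τ ≤ ‖x‖ ∧ ‖x‖ ≤ ρ + 1} with hS
  have hSm : MeasurableSet S := (measurableSet_le measurable_const measurable_norm).inter
      (measurableSet_le measurable_norm measurable_const)
  set K : Set (En n) := {x | δ ≤ ‖x‖ ∧ ‖x‖ ≤ ρ} with hK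
  have hKm : MeasurableSet K := (measurableSet_le measurable_const measurable_norm).inter
      (measurableSet_le measurable_norm measurable_const)
  have hKS : K ⊆ S := fun x hx => ⟨by linarith [hx.1], by linarith [hx.2]⟩
  obtain ⟨φ, hφc, hφ0, hφi, hφle, hφP⟩ := hDle g R (7 * τ) (ρ + 1) τ hg hτ (by linarith) hst
    ((expMeasure g).restrict S) rfl
  have hSle : expMeasure g S ≤ ENNReal.ofReal m :=
    (measure_mono fun x hx => mem_ball_zero_iff.2 (by linarith [hx.2])).trans
      (hA (ρ + 2) (by positivity))
  have hνm : ((expMeasure g).restrict S).real univ ≤ m := by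
    rw [Measure.real, Measure.restrict_apply_univ]
    exact ENNReal.toReal_le_of_le_ofReal hm0 hSle
  have hν0 : 0 ≤ ((expMeasure g).restrict S).real univ := measureReal_nonneg
  have hφX : ∫ x, φ x ^ 2 ∂(expMeasure g).restrict S ≤ X :=
    hφle.trans (by rw [hX]; gcongr)
  have hJle := decayInt_le hA0 ha0.le hA
  have hgle : ∀ x ∈ K, g x ≤ κ * 4 ^ a * φ x + C + c := by
    intro x hx
    have h1 := hφ0 x
    have h2 := wpot_le hs0 hn hg hSm hτ hx.2 (fun z hz => ?_)
      (P := 1 + 4 ^ a * φ x + k * m) (by positivity) hJ0 ((hφP x).trans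
        (ENNReal.ofReal_le_ofReal (by gcongr))) hJle
    · rw [hrep x]
      refine (add_le_add h2 le_rfl).trans_eq ?_
      rw [hC]; ring
    · rcases lt_or_ge ‖z‖ (7 * τ) with h | h
      · linarith [norm_sub_norm_le x z, hx.1]
      · have h3 : ρ + 1 < ‖z‖ := by
          by_contra! h4
          exact hz ⟨h, h4⟩
        have hδ1 : δ ≤ ρ := hx.1.trans hx.2
        have hδ2 : δ ≤ 1 := by
          rw [hρ, le_div_iff₀ hδ] at hδ1
          nlinarith
        linarith [norm_sub_norm_le z x, hx.2, norm_sub_rev x z]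
  have hpt : ∀ x ∈ K, ENNReal.ofReal (Real.exp (g x)) ≤ ENNReal.ofReal (Real.exp (-(K₀ / 2))) +
      ENNReal.ofReal (Real.exp (g x)) * ENNReal.ofReal ((κ * 4 ^ a / T) ^ 2 * φ x ^ 2) := by
    intro x hx
    rcases le_or_gt (g x) (-(K₀ / 2)) with h | h
    · exact le_add_right (ENNReal.ofReal_le_ofReal (Real.exp_le_exp.2 h))
    · refine le_add_left (le_mul_of_one_le_right zero_le ?_)
      rw [ENNReal.one_le_ofReal, ← mul_pow]
      refine one_le_pow₀ ?_
      rw [div_mul_eq_mul_div, one_le_div hT0]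
      linarith [hgle x hx]
  calc expMeasure g K = ∫⁻ x in K, ENNReal.ofReal (Real.exp (g x)) := by
        rw [expMeasure, withDensity_apply _ hKm]
    _ ≤ ∫⁻ x in K, (ENNReal.ofReal (Real.exp (-(K₀ / 2))) +
        ENNReal.ofReal (Real.exp (g x)) * ENNReal.ofReal ((κ * 4 ^ a / T) ^ 2 * φ x ^ 2)) :=
        setLIntegral_mono (by fun_prop) hpt
    _ = ENNReal.ofReal (Real.exp (-(K₀ / 2))) * volume K + ∫⁻ x in K,
        ENNReal.ofReal (Real.exp (g x)) * ENNReal.ofReal ((κ * 4 ^ a / T) ^ 2 * φ x ^ 2) := by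
        rw [lintegral_add_left measurable_const, setLIntegral_const]
    _ ≤ ENNReal.ofReal (Real.exp (-(K₀ / 2))) * ENNReal.ofReal V +
        ENNReal.ofReal ((κ * 4 ^ a / T) ^ 2 * X) := by
        refine add_le_add (mul_le_mul_right ?_ _) ?_
        · rw [hV, ofReal_measureReal (isCompact_closedBall _ _).measure_lt_top.ne]
          exact measure_mono fun x hx => mem_closedBall_zero_iff.2 hx.2
        · refine (lintegral_mono_set hKS).trans ?_
          have h1 : ∫⁻ x in S, ENNReal.ofReal ((κ * 4 ^ a / T) ^ 2 * φ x ^ 2) ∂expMeasure g =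
              ∫⁻ x in S, ENNReal.ofReal (Real.exp (g x)) *
                ENNReal.ofReal ((κ * 4 ^ a / T) ^ 2 * φ x ^ 2) := by
            rw [expMeasure, restrict_withDensity hSm]
            exact lintegral_withDensity_eq_lintegral_mul _ (by fun_prop) (by fun_prop)
          rw [← h1, ← ofReal_integral_eq_lintegral_ofReal (hφi.const_mul _)
            (Eventually.of_forall fun x => by dsimp only [Pi.zero_apply]; positivity),
            integral_const_mul]
          exact ENNReal.ofReal_le_ofReal (by gcongr)
    _ = ENNReal.ofReal (Real.exp (-(K₀ / 2)) * V + (κ * 4 ^ a / T) ^ 2 * X) := by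
        rw [← ENNReal.ofReal_mul (Real.exp_nonneg _), ENNReal.ofReal_add (by positivity)
          (by positivity)]
    _ ≤ ENNReal.ofReal ε := ENNReal.ofReal_le_ofReal hK1

/-- If the additive constant in the representation of `g` is very negative, then the decay
integral of `e^g` is small. -/
lemma exists_decayInt_le_of_const_le {n : ℕ} {s : ℝ} (hs : 1 < s) (hs2 : s < 2)
    (hn : 2 * s < n) {A ε : ℝ} (hA0 : 0 ≤ A) (hε : 0 < ε) :
    ∃ K₀ : ℝ, 0 ≤ K₀ ∧ ∃ ρ > 0, ∀ (g : En n → ℝ) (c R : ℝ), Continuous g → R ≤ ρ →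
      StableOutsideBall n s g R →
      (∀ r : ℝ, 0 < r → expMeasure g (ball 0 r) ≤ ENNReal.ofReal (A * r ^ ((n : ℝ) - 2 * s))) →
      (∀ x, g x = wpot n s g x + c) → c ≤ -K₀ →
      decayInt ((n : ℝ) - 2 * s) (expMeasure g) ≤ ENNReal.ofReal ε := by
  set a : ℝ := (n : ℝ) - 2 * s with ha
  have ha0 : 0 < a := by linarith
  have hlim : Tendsto (fun δ : ℝ => A * δ ^ a + ε / 2 + 2 * 2 ^ a * A * δ) (nhdsWithin 0 (Ioi 0))
      (nhds (A * 0 ^ a + ε / 2 + 2 * 2 ^ a * A * 0)) := by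
    refine Tendsto.mono_left ?_ nhdsWithin_le_nhds
    exact (((tendsto_id.rpow_const (Or.inr ha0.le)).const_mul A).add_const _).add
      (tendsto_id.const_mul _)
  rw [Real.zero_rpow ha0.ne', mul_zero, mul_zero, zero_add, add_zero] at hlim
  obtain ⟨δ, hδε, hδ⟩ := ((hlim.eventually (eventually_le_nhds (half_lt_self hε))).and
    self_mem_nhdsWithin).exists
  obtain ⟨K₀, hK₀, h⟩ := exists_expMeasure_annulus_le_of_const_le hs hs2 hn hA0 hδ (half_pos hε)
  refine ⟨K₀, hK₀, δ / 2, by positivity, fun g c R hg hR hst hA hrep hc => ?_⟩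
  refine (decayInt_le_of_annulus_le hA0 ha0.le hA hδ (one_div_pos.2 hδ) (half_pos hε).le
    (h g c R hg hR hst hA hrep hc)).trans (ENNReal.ofReal_le_ofReal ?_)
  rwa [div_div_eq_mul_div, div_one]

lemma uscale_uscale {n : ℕ} (s : ℝ) (u : En n → ℝ) {l t : ℝ} (hl : 0 < l) (ht : 0 < t) :
    uscale n s (uscale n s u l) t = uscale n s u (t * l) := by
  ext x
  simp only [uscale]
  rw [Real.log_mul ht.ne' hl.ne', smul_smul, mul_comm l t]
  ring

lemma forall_ge_of_forall_half {P : ℝ → Prop} {L : ℝ} (hL : 2 ≤ L)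
    (h0 : ∀ l, 1 ≤ l → l ≤ L → P l) (h1 : ∀ l, L ≤ l → P (l / 2) → P l) {l : ℝ} (hl : 1 ≤ l) :
    P l := by
  obtain ⟨k, hk⟩ := pow_unbounded_of_one_lt (l / L) (one_lt_two (α := ℝ))
  rw [div_lt_iff₀ (by linarith)] at hk
  induction k generalizing l with
  | zero => exact h0 l hl (by rw [pow_zero, one_mul] at hk; exact hk.le)
  | succ k ih =>
    rcases le_total l L with h | h
    · exact h0 l hl h
    · exact h1 l h (ih (by linarith) (by rw [pow_succ] at hk; linarith))

/-- (First assertion of Proposition 4.12 of the paper: `c_λ = O(1)`.)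
Let `1 < s < α < 2`, `n > 2s`, `n/(n-s) > 2α♯`.  Let `u ∈ C^{2α} ∩ L_{s/2}` solve
`(-Δ)^s u = e^u` with `(-Δ)^{s/2}u → 0` at infinity, stable outside a compact set.  Suppose
that for each `λ ≥ 1` there is `c_λ` with
`u^λ(x) = c(n,s) ∫ (|x-z|^{2s-n} - (1+|z|)^{2s-n}) e^{u^λ(z)} dz + c_λ` for all `x`.  Then
the constants `c_λ` are uniformly bounded for `λ ≥ 1`. -/
theorem representation_constants_bounded
    (n : ℕ) (s α : ℝ) (hs : 1 < s) (hsα : s < α) (hα : α < 2)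
    (hn : 2 * s < (n : ℝ))
    (αsh αst : ℝ)
    (hr1 : αst ^ 3 - 8 * αst + 4 = 0) (hr2 : αsh ^ 3 - 8 * αsh + 4 = 0)
    (hlt : αsh < αst)
    (hmax : ∀ x : ℝ, x ^ 3 - 8 * x + 4 = 0 → x ≤ αst)
    (hsecond : ∀ x : ℝ, x ^ 3 - 8 * x + 4 = 0 → x ≠ αst → x ≤ αsh)
    (hdim : (n : ℝ) / ((n : ℝ) - s) > 2 * αsh)
    (u v : En n → ℝ)
    (hreg : CHolder (2 * α) u)
    (hL : MeasureTheory.Integrable (fun z : En n => |u z| / (1 + ‖z‖) ^ ((n : ℝ) + s)))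
    (hv : HasFracLap n (s / 2) u v)
    (hv0 : Filter.Tendsto v (Filter.cocompact (En n)) (nhds 0))
    (heq : HasFracLap n (s / 2) v (fun x => Real.exp (u x)))
    (hstable : ∃ R > 0, StableOutsideBall n s u R)
    (c : ℝ → ℝ)
    (hrep : ∀ l : ℝ, 1 ≤ l → ∀ x : En n,
      uscale n s u l x = wpot n s (uscale n s u l) x + c l) :
    ∃ M : ℝ, ∀ l : ℝ, 1 ≤ l → |c l| ≤ M := by
  have hu : Continuous u := hreg.1.continuous
  have hs0 : 0 < s := by linarith
  have hs2 : s < 2 := hsα.trans hα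
  have hn1 : 1 ≤ n := by
    have : (1 : ℝ) ≤ n := by linarith
    exact_mod_cast this
  obtain ⟨R, hR, hst⟩ := hstable
  obtain ⟨A, hA0, hA⟩ := exists_expMeasure_ball_le hn1 hs0 hs2 hn hu hR hst
  have hAl : ∀ l : ℝ, 1 ≤ l → ∀ r : ℝ, 0 < r → expMeasure (uscale n s u l) (ball 0 r) ≤
      ENNReal.ofReal (A * r ^ ((n : ℝ) - 2 * s)) := fun l hl r hr =>
    expMeasure_uscale_ball_le hu hA (by linarith) hr
  have hκ := cRiesz_nonneg hs0 hn
  set κ := cRiesz n s with hκd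
  have hcont : ∀ l, Continuous (uscale n s u l) := continuous_uscale s hu
  set a : ℝ := (n : ℝ) - 2 * s with ha
  have ha0 : 0 < a := by linarith
  set B : ℝ := A * (1 + 2 ^ a + 2 * 2 ^ a) with hB
  have hB0 : 0 ≤ B := by positivity
  have hBl : ∀ l : ℝ, 1 ≤ l → decayInt a (expMeasure (uscale n s u l)) ≤ ENNReal.ofReal B :=
    fun l hl => decayInt_le hA0 ha0.le (hAl l hl)
  have hstep : ∀ l t b : ℝ, 1 ≤ l → 1 ≤ t → 0 ≤ b →
      decayInt a (expMeasure (uscale n s u l)) ≤ ENNReal.ofReal b →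
      c l + 2 * s * Real.log t - κ * (a * (t - 1) * b) ≤ c (t * l) := by
    intro l t b hl ht hb hd
    have htl : 1 ≤ t * l := one_le_mul_of_one_le_of_one_le ht hl
    have h := uscale_uscale s u (l := l) (t := t) (by linarith) (by linarith)
    refine add_log_sub_le_const_uscale hn1 hs0 hn (hcont l) ht hb hd ?_ (hrep l hl 0) ?_
    · rw [h]; exact ((hBl _ htl).trans_lt ENNReal.ofReal_lt_top).ne
    · rw [h]; exact hrep _ htl 0
  have hlog : 0 < Real.log 2 := Real.log_pos one_lt_two
  obtain ⟨K₀, hK₀, ρ, hρ, hsmall⟩ := exists_decayInt_le_of_const_le hs hs2 hn hA0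
    (ε := 2 * s * Real.log 2 / (κ * a + 1)) (by positivity)
  set L : ℝ := 2 * max 1 (R / ρ) with hLd
  have hL1 : 2 ≤ L := by linarith [le_max_left 1 (R / ρ)]
  set N : ℝ := max (κ * (a * L * B) - c 1) (K₀ + κ * (a * B)) with hN
  have hlow : ∀ l : ℝ, 1 ≤ l → -N ≤ c l := by
    intro l hl
    refine forall_ge_of_forall_half (P := fun l => -N ≤ c l) hL1 ?_ ?_ hl
    · intro l hl hlL
      have h1 := hstep 1 l B le_rfl hl hB0 (hBl 1 le_rfl)
      rw [mul_one] at h1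
      have h2 : 0 ≤ 2 * s * Real.log l := mul_nonneg (by linarith) (Real.log_nonneg hl)
      have h3 : κ * (a * (l - 1) * B) ≤ κ * (a * L * B) := by gcongr; linarith
      linarith [le_max_left (κ * (a * L * B) - c 1) (K₀ + κ * (a * B))]
    · intro l hlL ih
      have hl2 : 1 ≤ l / 2 := by linarith
      have h0 : 2 * (l / 2) = l := by ring
      rcases le_or_gt (c (l / 2)) (-K₀) with h | h
      · have hRl : R / (l / 2) ≤ ρ := by
          rw [div_le_iff₀ (by linarith), ← div_le_iff₀' hρ]
          linarith [le_max_right 1 (R / ρ)]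
        have h1 := hstep (l / 2) 2 _ hl2 one_le_two (by positivity) (hsmall _ _ _ (hcont _) hRl
          (hst.uscale hn1 hs0 hs2 (by linarith)) (hAl _ hl2) (hrep _ hl2) h)
        have h2 : κ * (a * (2 - 1) * (2 * s * Real.log 2 / (κ * a + 1))) ≤
            2 * s * Real.log 2 := by
          rw [show κ * (a * (2 - 1) * (2 * s * Real.log 2 / (κ * a + 1))) =
            2 * s * Real.log 2 * (κ * a / (κ * a + 1)) by ring]
          refine mul_le_of_le_one_right (by positivity) ?_
          rw [div_le_one (by positivity)]
          linarith
        rw [h0] at h1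
        linarith
      · have h1 := hstep (l / 2) 2 B hl2 one_le_two hB0 (hBl _ hl2)
        rw [h0] at h1
        have h2 : 0 ≤ 2 * s * Real.log 2 := by positivity
        linarith [le_max_right (κ * (a * L * B) - c 1) (K₀ + κ * (a * B))]
  have hV : 0 < volume.real (ball (0 : En n) 1) :=
    ENNReal.toReal_pos (measure_ball_pos volume _ one_pos).ne' measure_ball_lt_top.ne
  have hup : ∀ l : ℝ, 1 ≤ l → c l ≤ A / volume.real (ball (0 : En n) 1) := by
    intro l hl
    have h := exp_le_of_eq_wpot_add hn1 hs0 hn (hcont l) (hrep l hl) hA0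
      (by simpa using hAl l hl 1 one_pos)
    rw [← le_div_iff₀ hV] at h
    linarith [Real.add_one_le_exp (c l)]
  refine ⟨max N (A / volume.real (ball (0 : En n) 1)), fun l hl => abs_le.2 ⟨?_, ?_⟩⟩
  · linarith [hlow l hl, le_max_left N (A / volume.real (ball (0 : En n) 1))]
  · exact (hup l hl).trans (le_max_right _ _)
end
end

section
/- Let $n>4$ and let $u:\mathbb{R}^n\to\mathbb{R}$ be continuous and stable outside a compact set (in the fourth-order sense). For $\lambda\ge1$ set $u^\lambda(x)=u(\lambda x)+4\log\lambda$. Then there exists a constant $C>0$ such that $\int_{B_r} e^{u^\lambda}\,dx \le C r^{n-4}$ for every $\lambda\ge1$ and every $r\ge1$. -/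
open MeasureTheory Metric Filter Set

noncomputable section

/-- `u` is stable outside the ball `B_R` in the fourth-order sense:
`∫ e^u φ² ≤ ∫ (Δφ)²` for all `φ ∈ C_c^∞(ℝ^n \ closure B_R)`. -/
def Stable4OutsideBall (n : ℕ) (u : En n → ℝ) (R : ℝ) : Prop :=
  ∀ φ : En n → ℝ, TestOn n (Metric.closedBall (0 : En n) R)ᶜ φ →
    ∫ x, Real.exp (u x) * φ x ^ 2 ≤ ∫ x, (lap φ x) ^ 2

section

variable {n : ℕ}

lemma ContDiff.fderiv_apply_const {f : En n → ℝ} (hf : ContDiff ℝ (⊤ : ℕ∞) f) (v : En n) :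
    ContDiff ℝ (⊤ : ℕ∞) (fun y => fderiv ℝ f y v) :=
  (hf.fderiv_right (by simp)).clm_apply contDiff_const

lemma lap_sub {f g : En n → ℝ} (hf : ContDiff ℝ (⊤ : ℕ∞) f) (hg : ContDiff ℝ (⊤ : ℕ∞) g)
    (x : En n) : lap (fun y => f y - g y) x = lap f x - lap g x := by
  unfold lap
  rw [← Finset.sum_sub_distrib]
  refine Finset.sum_congr rfl fun i _ => ?_
  have h : ∀ y, fderiv ℝ (fun z => f z - g z) y = fderiv ℝ f y - fderiv ℝ g y := fun y =>
    fderiv_fun_sub (hf.differentiable (by simp) y) (hg.differentiable (by simp) y)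
  simp only [h, sub_apply]
  rw [fderiv_fun_sub ((hf.fderiv_apply_const _).differentiable (by simp) x)
    ((hg.fderiv_apply_const _).differentiable (by simp) x), sub_apply]

lemma lap_comp_smul {f : En n → ℝ} (hf : ContDiff ℝ (⊤ : ℕ∞) f) (c : ℝ) (x : En n) :
    lap (fun y => f (c • y)) x = c ^ 2 * lap f (c • x) := by
  unfold lap
  rw [Finset.mul_sum]
  refine Finset.sum_congr rfl fun i _ => ?_
  simp only [fderiv_comp_smul, smul_apply, smul_eq_mul]
  have hd : DifferentiableAt ℝ
      (fun y => fderiv ℝ f (c • y) (EuclideanSpace.single i (1 : ℝ))) x :=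
    ((hf.fderiv_apply_const _).comp (contDiff_const_smul c)).differentiable (by simp) x
  rw [fderiv_const_mul hd,
    fderiv_comp_smul (f := fun y => fderiv ℝ f y (EuclideanSpace.single i (1 : ℝ)))]
  simp only [smul_apply, smul_eq_mul]
  ring

lemma continuous_lap {f : En n → ℝ} (hf : ContDiff ℝ (⊤ : ℕ∞) f) : Continuous (lap f) :=
  continuous_finsetSum _ fun _ _ => ((hf.fderiv_apply_const _).fderiv_apply_const _).continuous

lemma HasCompactSupport.lap {f : En n → ℝ} (hf : HasCompactSupport f) :
    HasCompactSupport (lap f) := by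
  refine HasCompactSupport.of_support_subset_isCompact hf fun x hx => ?_
  by_contra hxf
  refine hx (Finset.sum_eq_zero fun i _ => ?_)
  refine image_eq_zero_of_notMem_tsupport (f := fun x => fderiv ℝ (fun y => fderiv ℝ f y
    (EuclideanSpace.single i (1 : ℝ))) x (EuclideanSpace.single i (1 : ℝ))) fun h => hxf ?_
  exact tsupport_fderiv_apply_subset ℝ _ (tsupport_fderiv_apply_subset ℝ _ h)

lemma HasCompactSupport.sq {f : En n → ℝ} (hf : HasCompactSupport f) :
    HasCompactSupport (fun x => f x ^ 2) := by
  simp only [pow_two]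
  exact hf.mul_right

lemma integrable_lap_sq {f : En n → ℝ} (hf : ContDiff ℝ (⊤ : ℕ∞) f) (hc : HasCompactSupport f) :
    Integrable (fun x => lap f x ^ 2) :=
  ((continuous_lap hf).pow 2).integrable_of_hasCompactSupport
    hc.lap.sq

/-- The biharmonic energy of `η (ρ⁻¹ x) - θ x` grows at most like `ρ ^ (n - 4)`. -/
lemma integral_lap_sq_smul_sub_le (hn : 4 ≤ n) {η θ : En n → ℝ}
    (hη : ContDiff ℝ (⊤ : ℕ∞) η) (hηc : HasCompactSupport η)
    (hθ : ContDiff ℝ (⊤ : ℕ∞) θ) (hθc : HasCompactSupport θ) {ρ : ℝ} (hρ : 1 ≤ ρ) :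
    ∫ x, lap (fun y => η (ρ⁻¹ • y) - θ y) x ^ 2 ≤
      2 * ((∫ x, lap η x ^ 2) + ∫ x, lap θ x ^ 2) * ρ ^ (n - 4) := by
  have hρ0 : 0 < ρ := by linarith
  have hs : ContDiff ℝ (⊤ : ℕ∞) (fun y : En n => η (ρ⁻¹ • y)) :=
    hη.comp (contDiff_const_smul _)
  have hsc : HasCompactSupport (fun y : En n => η (ρ⁻¹ • y)) :=
    hηc.comp_smul (inv_ne_zero hρ0.ne')
  have hscale : ∫ x, lap (fun y => η (ρ⁻¹ • y)) x ^ 2 = ρ ^ (n - 4) * ∫ x, lap η x ^ 2 := by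
    simp only [lap_comp_smul hη, mul_pow]
    rw [integral_const_mul, Measure.integral_comp_inv_smul_of_nonneg volume
      (fun x => lap η x ^ 2) hρ0.le, finrank_euclideanSpace_fin, smul_eq_mul, ← mul_assoc]
    congr 1
    rw [show ρ ^ n = ρ ^ 4 * ρ ^ (n - 4) by rw [← pow_add]; congr 1; omega]
    field_simp
  have hA := integrable_lap_sq hs hsc
  have hB := integrable_lap_sq hθ hθc
  have hB0 : 0 ≤ ∫ x, lap θ x ^ 2 := integral_nonneg fun x => sq_nonneg _
  calc ∫ x, lap (fun y => η (ρ⁻¹ • y) - θ y) x ^ 2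
      ≤ ∫ x, (2 * lap (fun y => η (ρ⁻¹ • y)) x ^ 2 + 2 * lap θ x ^ 2) := by
        refine integral_mono (integrable_lap_sq (hs.sub hθ) (hsc.sub hθc))
          ((hA.const_mul 2).add (hB.const_mul 2)) fun x => ?_
        simp only [lap_sub hs hθ]
        nlinarith [sq_nonneg (lap (fun y => η (ρ⁻¹ • y)) x + lap θ x)]
    _ = 2 * (ρ ^ (n - 4) * ∫ x, lap η x ^ 2) + 2 * ∫ x, lap θ x ^ 2 := by
        rw [integral_add (hA.const_mul 2) (hB.const_mul 2), integral_const_mul,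
          integral_const_mul, hscale]
    _ ≤ _ := by nlinarith [mul_le_mul_of_nonneg_left (one_le_pow₀ hρ (n := n - 4)) hB0]

/-- Energy growth on large balls for functions that are stable outside a ball. -/
lemma exists_setIntegral_ball_exp_le (hn : 4 ≤ n) {u : En n → ℝ} (hu : Continuous u) {R : ℝ}
    (hR : 0 < R) (hstable : Stable4OutsideBall n u R) :
    ∃ C > (0 : ℝ), ∀ ρ : ℝ, 1 ≤ ρ →
      ∫ x in ball (0 : En n) ρ, Real.exp (u x) ≤ C * ρ ^ (n - 4) := by
  let η : ContDiffBump (0 : En n) := ⟨1, 2, one_pos, one_lt_two⟩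
  let θ : ContDiffBump (0 : En n) := ⟨R + 1, R + 2, by linarith, by linarith⟩
  set K := ∫ x in ball (0 : En n) (R + 2), Real.exp (u x) with hK
  set A := ∫ x, lap η x ^ 2
  set B := ∫ x, lap θ x ^ 2
  have hexp : Continuous fun x => Real.exp (u x) := Real.continuous_exp.comp hu
  have hint : ∀ r : ℝ, IntegrableOn (fun x => Real.exp (u x)) (ball (0 : En n) r) := fun r =>
    (hexp.continuousOn.integrableOn_compact (isCompact_closedBall 0 r)).mono_set
      ball_subset_closedBall
  have hK0 : 0 ≤ K := integral_nonneg fun x => (Real.exp_pos _).le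
  have hA0 : 0 ≤ A := integral_nonneg fun x => sq_nonneg _
  have hB0 : 0 ≤ B := integral_nonneg fun x => sq_nonneg _
  refine ⟨K + 2 * (A + B) + 1, by positivity, fun ρ hρ => ?_⟩
  have hρ0 : 0 < ρ := by linarith
  have hpow : 1 ≤ ρ ^ (n - 4) := one_le_pow₀ hρ
  suffices h : ∫ x in ball (0 : En n) ρ, Real.exp (u x) ≤ K + 2 * (A + B) * ρ ^ (n - 4) by
    nlinarith [mul_le_mul_of_nonneg_left hpow hK0]
  rcases le_total ρ (R + 2) with hle | hge
  · have : ∫ x in ball (0 : En n) ρ, Real.exp (u x) ≤ K :=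
      setIntegral_mono_set (hint _) (ae_of_all _ fun x => (Real.exp_pos _).le)
        (ball_subset_ball hle).eventuallyLE
    have : 0 ≤ 2 * (A + B) * ρ ^ (n - 4) := by positivity
    linarith
  have hη_one : ∀ x : En n, ‖x‖ ≤ ρ → η (ρ⁻¹ • x) = 1 := fun x hx => by
    refine η.one_of_mem_closedBall ?_
    rw [mem_closedBall_zero_iff, norm_smul, norm_inv, Real.norm_of_nonneg hρ0.le]
    exact (inv_mul_le_one₀ hρ0).2 hx
  set φ : En n → ℝ := fun x => η (ρ⁻¹ • x) - θ x with hφ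
  have hφs : ContDiff ℝ (⊤ : ℕ∞) φ :=
    (η.contDiff.comp (contDiff_const_smul _)).sub θ.contDiff
  have hφc : HasCompactSupport φ :=
    (η.hasCompactSupport.comp_smul (inv_ne_zero hρ0.ne')).sub θ.hasCompactSupport
  have htest : TestOn n (closedBall (0 : En n) R)ᶜ φ := by
    refine ⟨hφs, hφc, fun x hx hxR => ?_⟩
    refine notMem_tsupport_iff_eventuallyEq.2 ?_ hx
    have hx1 : x ∈ ball (0 : En n) (R + 1) := closedBall_subset_ball (by linarith) hxR
    filter_upwards [isOpen_ball.mem_nhds hx1] with y hy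
    have hy' : ‖y‖ < R + 1 := mem_ball_zero_iff.1 hy
    have : θ y = 1 := θ.one_of_mem_closedBall (ball_subset_closedBall hy)
    simp [hφ, this, hη_one y (by linarith)]
  have hint' : Integrable fun x => Real.exp (u x) * φ x ^ 2 :=
    (hexp.mul (hφs.continuous.pow 2)).integrable_of_hasCompactSupport
      hφc.sq.mul_left
  have hle : ∫ x in ball (0 : En n) ρ, Real.exp (u x) ≤
      K + ∫ x, Real.exp (u x) * φ x ^ 2 := by
    rw [hK, ← integral_indicator measurableSet_ball, ← integral_indicator measurableSet_ball,
      ← integral_add ((hint _).integrable_indicator measurableSet_ball) hint']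
    refine integral_mono ((hint _).integrable_indicator measurableSet_ball)
      (((hint _).integrable_indicator measurableSet_ball).add hint') fun x => ?_
    have hpos := Real.exp_pos (u x)
    have hnn : 0 ≤ Real.exp (u x) * φ x ^ 2 := by positivity
    by_cases hx : ‖x‖ < R + 2
    · have hxρ : ‖x‖ < ρ := by linarith
      simpa [indicator, hx, hxρ] using hnn
    · by_cases hxρ : ‖x‖ < ρ
      · have hθ0 : θ x = 0 := θ.zero_of_le_dist (by simpa using hx)
        simp [indicator, hx, hxρ, hφ, hθ0, hη_one x hxρ.le]
      · simpa [indicator, hx, hxρ] using hnn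
  have := hstable φ htest
  have := integral_lap_sq_smul_sub_le hn η.contDiff η.hasCompactSupport θ.contDiff
    θ.hasCompactSupport hρ
  linarith

end

/-- (Lemma 6.5 of the paper.) Let `n > 4` and let `u : ℝ^n → ℝ` be
continuous and stable outside a compact set in the fourth-order sense.  With
`u^λ(x) = u(λx) + 4 log λ`, there is `C > 0` such that
`∫_{B_r} e^{u^λ} ≤ C r^{n-4}` for all `λ ≥ 1` and `r ≥ 1`. -/
theorem rescaled_energy_bound_fourth_order
    (n : ℕ) (hn : 4 < n)
    (u : En n → ℝ) (hu : Continuous u)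
    (hstable : ∃ R > 0, Stable4OutsideBall n u R) :
    ∃ C > (0:ℝ), ∀ l : ℝ, 1 ≤ l → ∀ r : ℝ, 1 ≤ r →
      ∫ x in Metric.ball (0 : En n) r, Real.exp (u (l • x) + 4 * Real.log l) ≤
        C * r ^ ((n : ℝ) - 4) := by
  obtain ⟨R, hR, hstab⟩ := hstable
  obtain ⟨C, hC, hbound⟩ := exists_setIntegral_ball_exp_le hn.le hu hR hstab
  refine ⟨C, hC, fun l hl r hr => ?_⟩
  have hl0 : 0 < l := by linarith
  have hr0 : 0 < r := by linarith
  have hexp : ∀ x : En n, Real.exp (u (l • x) + 4 * Real.log l) =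
      l ^ 4 * Real.exp (u (l • x)) := fun x => by
    rw [Real.exp_add, mul_comm, show (4 : ℝ) * Real.log l = Real.log (l ^ 4) by simp,
      Real.exp_log (by positivity)]
  have hpow : r ^ ((n : ℝ) - 4) = r ^ (n - 4) := by
    rw [← Real.rpow_natCast, Nat.cast_sub hn.le]
    norm_num
  simp only [hexp]
  rw [integral_const_mul, Measure.setIntegral_comp_smul_of_pos volume
    (fun x => Real.exp (u x)) _ hl0, finrank_euclideanSpace_fin, smul_eq_mul,
    _root_.smul_ball hl0.ne', smul_zero, Real.norm_of_nonneg hl0.le, hpow]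
  calc l ^ 4 * ((l ^ n)⁻¹ * ∫ x in ball (0 : En n) (l * r), Real.exp (u x))
      ≤ l ^ 4 * ((l ^ n)⁻¹ * (C * (l * r) ^ (n - 4))) := by
        gcongr
        exact hbound _ (one_le_mul_of_one_le_of_one_le hl hr)
    _ = C * r ^ (n - 4) := by
        rw [show l ^ n = l ^ 4 * l ^ (n - 4) by rw [← pow_add]; congr 1; omega, mul_pow]
        field_simp
end
end
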